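/- For n > 2, no singular holomorphic foliation of codimension one on CP^n admits a nontrivial minimal set; equivalently, the closure of every leaf of such a foliation meets the singular locus Sing F. -/

import Mathlib

/- STATEMENT 17 (Lins Neto): For n > 2, no singular holomorphic foliation of codimension
one on ℂℙⁿ admits a nontrivial minimal set; equivalently, the closure of every leaf
meets the singular locus Sing F.

Foliations on ℂℙⁿ are described in homogeneous coordinates (see context); points, leaves
and minimal sets are encoded by the corresponding cones in ℂ^{n+1} ∖ {0}. -/

open MvPolynomial

/-- A (singular) holomorphic foliation of codimension one and degree `d` on `ℂℙⁿ`,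
described in homogeneous coordinates by the integrable 1-form `ω = ∑ aᵢ dzᵢ` on
`ℂ^{n+1}`, whose coefficients are homogeneous polynomials of degree `d+1` satisfying the
Euler condition, with singular set of codimension at least 2. -/
structure ProjFoliation (n d : ℕ) where
  /-- coefficients of the defining 1-form `∑ aᵢ dzᵢ` -/
  a : Fin (n + 1) → MvPolynomial (Fin (n + 1)) ℂ
  /-- the coefficients are homogeneous of degree `d+1` -/
  homog : ∀ i, (a i).IsHomogeneous (d + 1)
  /-- the form is not identically zero -/
  nonzero : ∃ i, a i ≠ 0
  /-- integrability `ω ∧ dω = 0`, componentwise -/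
  integrable : ∀ i j k,
    a i * (pderiv j (a k) - pderiv k (a j)) +
    a j * (pderiv k (a i) - pderiv i (a k)) +
    a k * (pderiv i (a j) - pderiv j (a i)) = 0
  /-- Euler condition `∑ zᵢ aᵢ = 0` -/
  euler : ∑ i, X i * a i = 0
  /-- the zero set has codimension at least 2: the coefficients have no common
  nonconstant factor -/
  codim2 : ¬ ∃ q : MvPolynomial (Fin (n + 1)) ℂ, q.totalDegree ≠ 0 ∧ ∀ i, q ∣ a i

/-- The singular locus of the foliation, as a cone in `ℂ^{n+1} ∖ {0}`. -/
def ProjFoliation.singCone {n d : ℕ} (F : ProjFoliation n d) : Set (Fin (n + 1) → ℂ) :=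
  {z | z ≠ 0 ∧ ∀ i, eval z (F.a i) = 0}

/-- `S` is a cone: it is invariant under multiplication by nonzero complex scalars.
Subsets of `ℂℙⁿ` are encoded by the cones over them in `ℂ^{n+1} ∖ {0}`. -/
def IsCone {m : ℕ} (S : Set (Fin m → ℂ)) : Prop :=
  ∀ c : ℂ, c ≠ 0 → ∀ z ∈ S, c • z ∈ S

/-- The cone `S ⊆ ℂ^{n+1} ∖ {0}` represents a closed (= compact) subset of `ℂℙⁿ`:
it is closed in the punctured space `ℂ^{n+1} ∖ {0}`. -/
def IsClosedInPunctured {m : ℕ} (S : Set (Fin m → ℂ)) : Prop :=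
  ∀ z ∈ closure S, z ≠ 0 → z ∈ S

/-- The cone over a closed subset of `ℂℙⁿ`. -/
def IsProjectiveClosedSet {m : ℕ} (S : Set (Fin m → ℂ)) : Prop :=
  S.Nonempty ∧ (∀ z ∈ S, z ≠ 0) ∧ IsCone S ∧ IsClosedInPunctured S

/-- Two points are related if they lie on a common plaque of the foliation `F`: a
connected piece of a level set of a local holomorphic first integral `f` (a holomorphic
submersion with `df ∧ ω = 0`), away from the singular locus and the origin. -/
def ProjFoliation.PlaqueRel {n d : ℕ} (F : ProjFoliation n d)
    (p q : Fin (n + 1) → ℂ) : Prop :=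
  ∃ U : Set (Fin (n + 1) → ℂ), IsOpen U ∧ (∀ z ∈ U, z ≠ 0) ∧ Disjoint U F.singCone ∧
    ∃ f : (Fin (n + 1) → ℂ) → ℂ, DifferentiableOn ℂ f U ∧
      (∀ z ∈ U, fderiv ℂ f z ≠ 0) ∧
      (∀ z ∈ U, ∀ v w : Fin (n + 1) → ℂ,
        (∑ i, eval z (F.a i) * v i) * fderiv ℂ f z w =
        (∑ i, eval z (F.a i) * w i) * fderiv ℂ f z v) ∧
      p ∈ U ∧ q ∈ connectedComponentIn {z ∈ U | f z = f p} p

/-- The leaf of `F` through `p`: the set of points reachable from `p` by chains of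
plaques.  (Leaves are cones over the leaves of the foliation induced on `ℂℙⁿ`.) -/
def ProjFoliation.leaf {n d : ℕ} (F : ProjFoliation n d) (p : Fin (n + 1) → ℂ) :
    Set (Fin (n + 1) → ℂ) :=
  {q | Relation.ReflTransGen F.PlaqueRel p q}

/-- `S` is invariant under `F`: it is a union of leaves. -/
def ProjFoliation.IsInvariant {n d : ℕ} (F : ProjFoliation n d)
    (S : Set (Fin (n + 1) → ℂ)) : Prop :=
  ∀ p ∈ S, F.leaf p ⊆ S

/-- A nontrivial minimal set of `F`, encoded as a cone in `ℂ^{n+1} ∖ {0}` (so that it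
represents a compact subset of `ℂℙⁿ`): a nonempty closed invariant set, minimal among
nonempty closed invariant subsets, and disjoint from the singular locus. -/
def ProjFoliation.IsNontrivialMinimalSet {n d : ℕ} (F : ProjFoliation n d)
    (Y : Set (Fin (n + 1) → ℂ)) : Prop :=
  Y.Nonempty ∧ (∀ z ∈ Y, z ≠ 0) ∧ IsCone Y ∧ IsClosedInPunctured Y ∧
  F.IsInvariant Y ∧ Disjoint Y F.singCone ∧
  (∀ Y' ⊆ Y, Y'.Nonempty → IsClosedInPunctured Y' → F.IsInvariant Y' → Y' = Y)

theorem exists_prime_dvd_of_dvd_algebraMap_mul {R T : Type*} [CommRing R] [IsDomain R]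
    [UniqueFactorizationMonoid R] [CommRing T] [Algebra R T] [Module.Free R T]
    [Algebra.IsIntegral R T] {g h : T} (hg : g ∈ nonZeroDivisors T) (hgh : ¬ g ∣ h) :
    ∃ q : R, Prime q ∧ ∀ x : R, g ∣ algebraMap R T x * h → q ∣ x := by
  have : Nontrivial T := by
    by_contra hT
    rw [not_nontrivial_iff_subsingleton] at hT
    exact hgh ⟨0, Subsingleton.elim _ _⟩
  obtain ⟨g', δ, hδ, hgg⟩ := IsAlgebraic.exists_smul_eq_mul (R := R) (1 : T)
    (Algebra.IsIntegral.isIntegral (R := R) g).isAlgebraic hg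
  let b := Module.Free.chooseBasis R T
  have key : ∃ i, ¬ δ ∣ b.repr (g' * h) i := by
    by_contra! hall
    choose c hc using hall
    have hfin : (Function.support c).Finite := by
      refine (b.repr (g' * h)).hasFiniteSupport.subset fun i hi => ?_
      simp only [Function.mem_support] at hi ⊢
      rw [hc i]
      exact mul_ne_zero hδ hi
    have hy : g' * h = δ • b.repr.symm (Finsupp.ofSupportFinite c hfin) := by
      apply b.repr.injective
      ext i
      rw [map_smul, LinearEquiv.apply_symm_apply, hc i]
      rfl
    refine hgh ⟨b.repr.symm (Finsupp.ofSupportFinite c hfin), smul_right_injective T hδ ?_⟩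
    show δ • h = δ • (g * _)
    rw [← mul_smul_comm, ← hy, ← mul_assoc, ← hgg, smul_mul_assoc, one_mul]
  obtain ⟨i, hi⟩ := key
  obtain ⟨δ', u', γ, hrel, h1, h2⟩ :=
    UniqueFactorizationMonoid.exists_reduced_factors δ hδ (b.repr (g' * h) i)
  have hδ' : ¬ IsUnit δ' := fun hu => hi (by
    rw [← h1, ← h2]
    exact mul_dvd_mul_left _ (hu.dvd))
  have hδ0 : δ' ≠ 0 := by rintro rfl; simp at h1; exact hδ h1.symm
  have hγ : γ ≠ 0 := by rintro rfl; simp at h1; exact hδ h1.symm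
  obtain ⟨q, hq, hqδ⟩ := WfDvdMonoid.exists_irreducible_factor hδ' hδ0
  refine ⟨q, UniqueFactorizationMonoid.irreducible_iff_prime.1 hq, fun x ⟨y, hy⟩ => hqδ.trans ?_⟩
  have h3 : x • (g' * h) = δ • y := by
    rw [Algebra.smul_def, mul_left_comm, hy, ← mul_assoc, mul_comm g', ← hgg, smul_mul_assoc,
      one_mul]
  have h4 : x * b.repr (g' * h) i = δ * b.repr y i := by
    have := congrArg (fun t => b.repr t i) h3
    simpa using this
  rw [← h1, ← h2] at h4
  have h5 : x * u' = δ' * b.repr y i := mul_left_cancel₀ hγ (by linear_combination h4)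
  exact hrel.dvd_of_dvd_mul_right ⟨_, h5⟩

/-- The ideal of multipliers of `h` into `g T` is contained in a prime with two free variables left. -/
theorem exists_prime_two_free_variables {n : ℕ} (hn : 2 < n)
    {T : Type*} [CommRing T] [Algebra (MvPolynomial (Fin n) ℂ) T]
    [Module.Free (MvPolynomial (Fin n) ℂ) T] [Algebra.IsIntegral (MvPolynomial (Fin n) ℂ) T]
    {g h : T} (hg : g ∈ nonZeroDivisors T) (hgh : ¬ g ∣ h) :
    ∃ Q : Ideal T, Q.IsPrime ∧ (∀ x, g ∣ x * h → x ∈ Q) ∧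
      ∃ v : Fin 2 → Fin n, ∀ r : MvPolynomial (Fin 2) ℂ,
        algebraMap _ T (rename v r) ∈ Q → r = 0 := by
  obtain ⟨q, hq, hdvd⟩ := exists_prime_dvd_of_dvd_algebraMap_mul
    (R := MvPolynomial (Fin n) ℂ) hg hgh
  let J : Ideal T :=
    { carrier := {x | g ∣ x * h}
      add_mem' := fun {a b} ha hb => by
        show g ∣ (a + b) * h
        rw [add_mul]; exact dvd_add ha hb
      zero_mem' := by simp
      smul_mem' := fun c x hx => by
        show g ∣ c * x * h
        rw [mul_assoc]; exact Dvd.dvd.mul_left hx c }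
  have : (Ideal.span {q}).IsPrime := (Ideal.span_singleton_prime hq.ne_zero).2 hq
  obtain ⟨Q, hJQ, hQ, hcomap⟩ := Ideal.exists_ideal_over_prime_of_isIntegral
    (Ideal.span {q}) J (fun x hx => Ideal.mem_span_singleton.2 (hdvd x hx))
  refine ⟨Q, hQ, fun x hx => hJQ hx, ?_⟩
  have hvar : ∃ i, q.degreeOf i ≠ 0 := by
    by_contra! hall
    have : q.totalDegree = 0 := by
      rw [totalDegree_eq_zero_iff]
      intro m hm i
      have := hall i
      rw [degreeOf_eq_sup] at this
      exact (Finset.sup_eq_bot_iff _ _).1 this m hm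
    rw [totalDegree_eq_zero_iff_eq_C] at this
    apply hq.not_isUnit
    rw [this]
    refine IsUnit.map C (isUnit_iff_ne_zero.2 fun h0 => hq.ne_zero ?_)
    rw [this, h0, C_0]
  obtain ⟨i, hi⟩ := hvar
  have hcard : 2 ≤ Fintype.card {j : Fin n // j ≠ i} := by
    rw [Fintype.card_subtype_compl]; simp; omega
  obtain ⟨e⟩ : Nonempty (Fin 2 ↪ {j : Fin n // j ≠ i}) :=
    Function.Embedding.nonempty_of_card_le (by simpa using hcard)
  have hv : Function.Injective (fun k => (e k : Fin n)) :=
    Subtype.val_injective.comp e.injective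
  refine ⟨fun k => e k, fun r hr => ?_⟩
  have hmem : rename (fun k => (e k : Fin n)) r ∈ Ideal.span {q} := by
    rw [← hcomap]; exact hr
  obtain ⟨s, hs⟩ := Ideal.mem_span_singleton.1 hmem
  by_contra hr0
  have hne : rename (fun k => (e k : Fin n)) r ≠ 0 := fun h0 =>
    hr0 (rename_injective _ hv (by rw [h0, map_zero]))
  have hs0 : s ≠ 0 := by rintro rfl; exact hne (by rw [hs, mul_zero])
  have hdeg : degreeOf i (rename (fun k => (e k : Fin n)) r) = 0 := by
    by_contra hd
    have : i ∈ (rename (fun k => (e k : Fin n)) r).vars := by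
      rw [vars_def, Multiset.mem_toFinset, ← Multiset.count_ne_zero]
      simpa [degreeOf_def] using hd
    have := vars_rename _ _ this
    simp only [Finset.mem_image] at this
    obtain ⟨k, -, hk⟩ := this
    exact (e k).2 hk
  rw [hs, degreeOf_mul_eq hq.ne_zero hs0] at hdeg
  omega

theorem coeff_linear_monomial {n : ℕ} {B : Type*} [CommRing B] (l : Fin n → Polynomial B)
    (c : Fin n → B) (hl : ∀ i, (l i).natDegree ≤ 1) (hc : ∀ i, (l i).coeff 1 = c i)
    (m : Fin n →₀ ℕ) :
    (∏ i, l i ^ m i).natDegree ≤ m.degree ∧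
      (∏ i, l i ^ m i).coeff m.degree = ∏ i, c i ^ m i := by
  rw [Finsupp.degree_eq_sum]
  induction (Finset.univ : Finset (Fin n)) using Finset.cons_induction with
  | empty => simp
  | cons a s ha ih =>
    rw [Finset.prod_cons, Finset.prod_cons, Finset.sum_cons]
    have h1 : (l a ^ m a).natDegree ≤ m a := by
      simpa using Polynomial.natDegree_pow_le_of_le (m a) (hl a)
    have h2 : (l a ^ m a).coeff (m a) = c a ^ m a := by
      have := Polynomial.coeff_pow_of_natDegree_le (m := m a) (hl a)
      rwa [mul_one, hc] at this
    exact ⟨Polynomial.natDegree_mul_le_of_le h1 ih.1, by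
      rw [Polynomial.coeff_mul_add_eq_of_natDegree_le h1 ih.1, h2, ih.2]⟩

theorem IsHomogeneous.coeff_aeval_linear {n e : ℕ} {B : Type*} [CommRing B] [Algebra ℂ B]
    {f : MvPolynomial (Fin n) ℂ} (hf : f.IsHomogeneous e) (l : Fin n → Polynomial B)
    (v : Fin n → ℂ) (hl : ∀ i, (l i).natDegree ≤ 1)
    (hc : ∀ i, (l i).coeff 1 = algebraMap ℂ B (v i)) :
    (aeval l f).natDegree ≤ e ∧ (aeval l f).coeff e = algebraMap ℂ B (eval v f) := by
  have hsum : aeval l f = ∑ m ∈ f.support, algebraMap ℂ _ (f.coeff m) * ∏ i, l i ^ m i := by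
    rw [aeval_def, eval₂_eq']
  have hmon : ∀ m ∈ f.support, m.degree = e := fun m hm => by
    have := hf (mem_support_iff.1 hm)
    exact (DFunLike.congr_fun (Finsupp.degree_eq_weight_one (R := ℕ)) m).trans this
  constructor
  · rw [hsum]
    refine Polynomial.natDegree_sum_le_of_forall_le _ _ fun m hm => ?_
    rw [IsScalarTower.algebraMap_apply ℂ B (Polynomial B), Polynomial.algebraMap_eq]
    refine (Polynomial.natDegree_C_mul_le _ _).trans ?_
    rw [← hmon m hm]
    exact (coeff_linear_monomial l _ hl hc m).1
  · rw [hsum, Polynomial.finsetSum_coeff, eval_eq', map_sum]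
    refine Finset.sum_congr rfl fun m hm => ?_
    rw [IsScalarTower.algebraMap_apply ℂ B (Polynomial B), Polynomial.algebraMap_eq,
      Polynomial.coeff_C_mul, ← hmon m hm, (coeff_linear_monomial l _ hl hc m).2]
    simp

theorem exists_surjective_to_free {n e : ℕ} {f : MvPolynomial (Fin (n + 1)) ℂ}
    (hf : f.IsHomogeneous e) (hf0 : f ≠ 0) :
    ∃ p : Polynomial (MvPolynomial (Fin n) ℂ), p.Monic ∧
      ∃ Θ : MvPolynomial (Fin (n + 1)) ℂ →ₐ[ℂ] AdjoinRoot p, Function.Surjective Θ ∧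
        ∀ x, Θ x = 0 ↔ f ∣ x := by
  obtain ⟨v, hv⟩ : ∃ v, eval v (f * X 0) ≠ 0 := by
    by_contra! hall
    have : f * X 0 = 0 := MvPolynomial.funext fun x => by rw [hall x, map_zero]
    exact (mul_ne_zero hf0 (X_ne_zero 0)) this
  rw [map_mul, eval_X] at hv
  have hfv : eval v f ≠ 0 := left_ne_zero_of_mul hv
  have hv0 : v 0 ≠ 0 := right_ne_zero_of_mul hv
  let l : Fin (n + 1) → Polynomial (MvPolynomial (Fin n) ℂ) := fun i =>
    Polynomial.C (C (v i)) * Polynomial.X +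
      Polynomial.C (Fin.cases 0 (fun j => X j) i : MvPolynomial (Fin n) ℂ)
  let Ψ : MvPolynomial (Fin (n + 1)) ℂ →ₐ[ℂ] Polynomial (MvPolynomial (Fin n) ℂ) := aeval l
  let σ : MvPolynomial (Fin n) ℂ →ₐ[ℂ] MvPolynomial (Fin (n + 1)) ℂ :=
    aeval fun j => X j.succ - C (v j.succ * (v 0)⁻¹) * X 0
  let Ξ : Polynomial (MvPolynomial (Fin n) ℂ) →ₐ[ℂ] MvPolynomial (Fin (n + 1)) ℂ :=
    { Polynomial.eval₂RingHom σ.toRingHom (C (v 0)⁻¹ * X 0) with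
      commutes' := fun c => by
        rw [IsScalarTower.algebraMap_apply ℂ (MvPolynomial (Fin n) ℂ)]
        simp [Polynomial.algebraMap_eq] }
  have hΞC : ∀ b, Ξ (Polynomial.C b) = σ b := fun b => by
    show Polynomial.eval₂RingHom σ.toRingHom (C (v 0)⁻¹ * X 0) (Polynomial.C b) = _
    simp
  have hΞX : Ξ Polynomial.X = C (v 0)⁻¹ * X 0 := by
    show Polynomial.eval₂RingHom σ.toRingHom (C (v 0)⁻¹ * X 0) Polynomial.X = _
    simp
  have hcv : (C (v 0) * C (v 0)⁻¹ : MvPolynomial (Fin (n + 1)) ℂ) = 1 := by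
    rw [← C_mul, mul_inv_cancel₀ hv0, C_1]
  have hσC : ∀ c, σ (C c) = C c := fun c => by simp [σ]
  have hΞΨ : ∀ x, Ξ (Ψ x) = x := by
    intro x
    have : Ξ.comp Ψ = AlgHom.id ℂ _ := by
      ext1 i
      simp only [AlgHom.comp_apply, AlgHom.id_apply, Ψ, aeval_X, l, map_add, map_mul, hΞC, hΞX,
        hσC]
      refine Fin.cases ?_ (fun j => ?_) i
      · simp only [Fin.cases_zero, map_zero, add_zero]
        rw [← mul_assoc, hcv, one_mul]
      · simp only [Fin.cases_succ, σ, aeval_X, C_mul]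
        ring
    exact DFunLike.congr_fun this x
  have hσX : ∀ j, Ψ (σ (X j)) = Polynomial.C (X j) := by
    intro j
    have hcv' : (C (v 0)⁻¹ * C (v 0) : MvPolynomial (Fin n) ℂ) = 1 := by
      rw [← C_mul, inv_mul_cancel₀ hv0, C_1]
    have hΨC : ∀ c, Ψ (C c) = Polynomial.C (C c) := fun c => by
      simp only [Ψ, algHom_C]
      rfl
    simp only [σ, aeval_X, map_sub, map_mul, hΨC, Ψ, l, Fin.cases_zero, Fin.cases_succ]
    simp only [Polynomial.C_0, add_zero]
    rw [show ∀ a b x y : Polynomial (MvPolynomial (Fin n) ℂ), ∀ c,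
      a * x + y - a * b * (c * x) = a * x * (1 - b * c) + y from fun a b x y c => by ring,
      ← Polynomial.C_mul, hcv', Polynomial.C_1]
    ring
  have hΨσ : ∀ b, Ψ (σ b) = Polynomial.C b := by
    intro b
    have : Ψ.comp σ = Algebra.algHom ℂ (MvPolynomial (Fin n) ℂ) (Polynomial (MvPolynomial (Fin n) ℂ)) := by
      ext1 j
      exact hσX j
    exact DFunLike.congr_fun this b
  have hΨX : Ψ (C (v 0)⁻¹ * X 0) = Polynomial.X := by
    have hΨC : ∀ c, Ψ (C c) = Polynomial.C (C c) := fun c => by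
      simp only [Ψ, algHom_C]
      rfl
    rw [map_mul, hΨC]
    simp only [Ψ, aeval_X, l, Fin.cases_zero, Polynomial.C_0, add_zero]
    rw [← mul_assoc, ← Polynomial.C_mul, ← C_mul, inv_mul_cancel₀ hv0, C_1, Polynomial.C_1,
      one_mul]
  have hΨsurj : Function.Surjective Ψ := by
    intro p
    induction p using Polynomial.induction_on with
    | C b => exact ⟨σ b, hΨσ b⟩
    | add p q hp hq =>
      obtain ⟨a, rfl⟩ := hp
      obtain ⟨b, rfl⟩ := hq
      exact ⟨a + b, map_add _ _ _⟩
    | monomial k b _ =>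
      exact ⟨σ b * (C (v 0)⁻¹ * X 0) ^ (k + 1), by rw [map_mul, map_pow, hΨX, hΨσ]⟩
  have hlead := IsHomogeneous.coeff_aeval_linear hf l v
    (fun i => by
      refine (Polynomial.natDegree_add_le _ _).trans ?_
      simp only [Polynomial.natDegree_C, Nat.max_zero]
      exact (Polynomial.natDegree_C_mul_le _ _).trans Polynomial.natDegree_X_le)
    (fun i => by
      simp only [l, Polynomial.coeff_add, Polynomial.coeff_C_mul, Polynomial.coeff_X_one, mul_one,
        Polynomial.coeff_C_succ, add_zero]
      rfl)
  let w : MvPolynomial (Fin n) ℂ := C (eval v f)⁻¹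
  have hw : IsUnit (Polynomial.C w) :=
    IsUnit.map Polynomial.C (IsUnit.map C (isUnit_iff_ne_zero.2 (inv_ne_zero hfv)))
  have hmonic : (Polynomial.C w * Ψ f).Monic := by
    refine Polynomial.monic_of_natDegree_le_of_coeff_eq_one e
      ((Polynomial.natDegree_C_mul_le _ _).trans hlead.1) ?_
    rw [Polynomial.coeff_C_mul, hlead.2]
    show C (eval v f)⁻¹ * C (eval v f) = 1
    rw [← C_mul, inv_mul_cancel₀ hfv, C_1]
  refine ⟨Polynomial.C w * Ψ f, hmonic, (AdjoinRoot.mkₐ _).restrictScalars ℂ |>.comp Ψ, ?_, ?_⟩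
  · exact (AdjoinRoot.mk_surjective).comp hΨsurj
  · intro x
    show AdjoinRoot.mk _ (Ψ x) = 0 ↔ _
    rw [AdjoinRoot.mk_eq_zero, hw.mul_left_dvd]
    constructor
    · rintro ⟨y, hy⟩
      refine ⟨Ξ y, ?_⟩
      rw [← hΞΨ x, hy, map_mul, hΞΨ]
    · rintro ⟨y, rfl⟩
      exact ⟨Ψ y, map_mul _ _ _⟩

theorem eq_smul_of_wedge_eq_zero {ι S : Type*} [Fintype ι] [CommRing S] [IsDomain S]
    (a α β C : ι → S)
    (hα : ∑ i, α i * a i ≠ 0)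
    (hrel : ∀ x, ∑ i, α i * a i ∣ (∑ i, β i * a i) * x → ∑ i, α i * a i ∣ x)
    (hC : ∀ j k, a j * C k = a k * C j) : ∃ r, ∀ k, C k = r * a k := by
  have hf : ∀ γ : ι → S, ∀ k, (∑ i, γ i * a i) * C k = a k * ∑ i, γ i * C i := fun γ k => by
    rw [Finset.sum_mul, Finset.mul_sum]
    refine Finset.sum_congr rfl fun i _ => ?_
    rw [mul_assoc, hC i k]; ring
  obtain ⟨r, hr⟩ := hrel (∑ i, α i * C i) ⟨∑ i, β i * C i, by
    rw [Finset.sum_mul, Finset.mul_sum]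
    refine Finset.sum_congr rfl fun i _ => ?_
    rw [mul_assoc, ← hf α i]; ring⟩
  refine ⟨r, fun k => mul_left_cancel₀ hα ?_⟩
  rw [hf α k, hr]; ring

theorem exists_koszul_multiplier {ι S : Type*} [Fintype ι] [CommRing S] [IsDomain S]
    (a α β : ι → S) (b : ι → ι → S) (hb : ∀ i j, b i j = - b j i)
    (hab : ∀ i j k, a i * b j k + a j * b k i + a k * b i j = 0)
    (hα : ∑ i, α i * a i ≠ 0)
    (hrel : ∀ x, ∑ i, α i * a i ∣ (∑ i, β i * a i) * x → ∑ i, α i * a i ∣ x) :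
    ∃ h, (∀ l, ∃ s t, a l * h = (∑ i, α i * a i) * s + (∑ i, β i * a i) * t) ∧
      ((∃ s t, h = (∑ i, α i * a i) * s + (∑ i, β i * a i) * t) →
        ∃ e : ι → S, ∀ j k, b j k = a j * e k - a k * e j) := by
  have hc : ∀ γ : ι → S, ∀ j k, (∑ i, γ i * a i) * b j k =
      a j * (∑ i, γ i * b i k) - a k * (∑ i, γ i * b i j) := fun γ j k => by
    rw [Finset.sum_mul, Finset.mul_sum, Finset.mul_sum, ← Finset.sum_sub_distrib]
    refine Finset.sum_congr rfl fun i _ => ?_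
    have := hab i j k
    rw [hb k i] at this
    linear_combination γ i * this
  set f := ∑ i, α i * a i
  set g := ∑ i, β i * a i
  set cf : ι → S := fun k => ∑ i, α i * b i k
  set cg : ι → S := fun k => ∑ i, β i * b i k
  have hcf : ∀ j k, f * b j k = a j * cf k - a k * cf j := hc α
  have hcg : ∀ j k, g * b j k = a j * cg k - a k * cg j := hc β
  have hpar := eq_smul_of_wedge_eq_zero a α β (hα := hα) (hrel := hrel)
  obtain ⟨h, hh⟩ := hpar (fun k => g * cf k - f * cg k) fun j k => by
    linear_combination (-g) * hcf j k + f * hcg j k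
  obtain ⟨i₀, hi₀⟩ : ∃ i, a i ≠ 0 := by
    by_contra! hall
    exact hα (Finset.sum_eq_zero fun i _ => by rw [hall i, mul_zero])
  refine ⟨h, fun l => ?_, fun ⟨s, t, hst⟩ => ?_⟩
  · obtain ⟨r, hr⟩ := hpar (fun k => a l * cf k - f * b l k) fun j k => by
      have := hab l j k
      rw [hb k l] at this
      linear_combination (-a l) * hcf j k + f * this
    obtain ⟨r', hr'⟩ := hpar (fun k => a l * cg k - g * b l k) fun j k => by
      have := hab l j k
      rw [hb k l] at this
      linear_combination (-a l) * hcg j k + g * this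
    refine ⟨-r', r, mul_right_cancel₀ hi₀ ?_⟩
    linear_combination (-a l) * hh i₀ + g * hr i₀ - f * hr' i₀
  · have : ∀ k, ∃ e, cf k - a k * t = f * e := fun k =>
      hrel _ ⟨cg k + a k * s, by linear_combination hh k + a k * hst⟩
    choose e he using this
    refine ⟨e, fun j k => mul_left_cancel₀ hα ?_⟩
    linear_combination hcf j k + a j * he k - a k * he j

theorem MvPolynomial.totalDegree_ne_zero_of_prime {σ K : Type*} [Field K] {q : MvPolynomial σ K}
    (hq : Prime q) : q.totalDegree ≠ 0 := by
  intro h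
  rw [totalDegree_eq_zero_iff_eq_C] at h
  apply hq.not_isUnit
  rw [h]
  refine IsUnit.map C (isUnit_iff_ne_zero.2 fun h0 => hq.ne_zero ?_)
  rw [h, h0, C_0]

theorem MvPolynomial.IsHomogeneous.coeff_mul_eq_zero {σ R : Type*} [CommSemiring R]
    {a : MvPolynomial σ R} {d : ℕ} (ha : a.IsHomogeneous d) (e : MvPolynomial σ R) (m : σ →₀ ℕ)
    (hm : m.degree < d) : coeff m (a * e) = 0 := by
  classical
  rw [coeff_mul]
  refine Finset.sum_eq_zero fun x hx => ?_
  rw [Finset.HasAntidiagonal.mem_antidiagonal] at hx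
  by_cases h : coeff x.1 a = 0
  · rw [h, zero_mul]
  · have h1 := (DFunLike.congr_fun (Finsupp.degree_eq_weight_one (R := ℕ)) x.1).trans (ha h)
    have h2 := congrArg Finsupp.degree hx
    rw [map_add] at h2
    omega

theorem exists_coprime_combination {ι S : Type*} [Fintype ι] [CommRing S] [IsDomain S]
    [UniqueFactorizationMonoid S] (a : ι → S) (ha : ∀ q, Prime q → ∃ i, ¬ q ∣ a i)
    {f : S} (hf : f ≠ 0) :
    ∃ β : ι → S, ∀ x, f ∣ (∑ i, β i * a i) * x → f ∣ x := by
  classical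
  set s := (UniqueFactorizationMonoid.factors f).toFinset
  have hs : ∀ q ∈ s, Prime q := fun q hq =>
    UniqueFactorizationMonoid.prime_of_factor q (Multiset.mem_toFinset.1 hq)
  have hnot : ¬ ((Ideal.span (Set.range a) : Ideal S) : Set S) ⊆
      ⋃ q ∈ (s : Set S), (Ideal.span {q} : Ideal S) := by
    rw [Ideal.subset_union_prime (0 : S) 0 fun q hq _ _ =>
      (Ideal.span_singleton_prime (hs q hq).ne_zero).2 (hs q hq)]
    rintro ⟨q, hq, hle⟩
    obtain ⟨i, hi⟩ := ha q (hs q hq)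
    exact hi (Ideal.mem_span_singleton.1 (hle (Ideal.subset_span ⟨i, rfl⟩)))
  obtain ⟨g, hg, hgn⟩ := Set.not_subset.1 hnot
  obtain ⟨β, rfl⟩ := (Ideal.mem_span_range_iff_exists_fun).1 hg
  have hgq : ∀ q, Prime q → q ∣ f → ¬ q ∣ ∑ i, β i * a i := fun q hq hqf hqg => by
    obtain ⟨p, hp, hpq⟩ := UniqueFactorizationMonoid.exists_mem_factors_of_dvd hf hq.irreducible hqf
    refine hgn (Set.mem_iUnion₂.2 ⟨p, Multiset.mem_toFinset.2 hp, ?_⟩)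
    exact Ideal.mem_span_singleton.2 (hpq.symm.dvd.trans hqg)
  refine ⟨β, fun x hx => IsRelPrime.dvd_of_dvd_mul_left (fun d hd hdg => ?_) hx⟩
  by_contra hu
  have hd0 : d ≠ 0 := by rintro rfl; exact hf (zero_dvd_iff.1 hd)
  obtain ⟨q, hq, hqd⟩ := WfDvdMonoid.exists_irreducible_factor hu hd0
  exact hgq q hq.prime (hqd.trans hd) (hqd.trans hdg)

theorem ProjFoliation.exists_curl_ne_zero {n d : ℕ} (F : ProjFoliation n d) :
    ∃ j k, pderiv j (F.a k) - pderiv k (F.a j) ≠ 0 := by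
  by_contra! hall
  obtain ⟨j, hj⟩ := F.nonzero
  have h1 := congrArg (pderiv j) F.euler
  simp only [map_sum, Derivation.leibniz, smul_eq_mul, pderiv_X, map_zero,
    Finset.sum_add_distrib] at h1
  have h2 : ∑ k, X k * pderiv k (F.a j) = (d + 1) • F.a j := (F.homog j).sum_X_mul_pderiv
  have h3 : ∑ k, X k * pderiv j (F.a k) = (d + 1) • F.a j := by
    rw [← h2]
    exact Finset.sum_congr rfl fun k _ => by rw [sub_eq_zero.1 (hall j k)]
  rw [h3] at h1
  have h4 : ∑ x, F.a x * (Pi.single j (1 : MvPolynomial (Fin (n + 1)) ℂ) : _ → _) x = F.a j := by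
    simp [Pi.single_apply]
  have h5 : ((d + 2 : ℕ) : MvPolynomial (Fin (n + 1)) ℂ) * F.a j = 0 := by
    rw [nsmul_eq_mul] at h1
    push_cast at h1 ⊢
    rw [← h4]
    rw [h4]
    rw [h4] at h1
    linear_combination h1
  rcases mul_eq_zero.1 h5 with h | h
  · exact absurd h (by exact_mod_cast (by omega : d + 2 ≠ 0))
  · exact hj h

theorem ProjFoliation.exists_prime {n d : ℕ} (hn : 2 < n) (F : ProjFoliation n d) :
    ∃ P : Ideal (MvPolynomial (Fin (n + 1)) ℂ), P.IsPrime ∧ (∀ i, F.a i ∈ P) ∧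
      ∃ u : Fin 2 → MvPolynomial (Fin (n + 1)) ℂ,
        ∀ r : MvPolynomial (Fin 2) ℂ, aeval u r ∈ P → r = 0 := by
  classical
  obtain ⟨i₀, hi₀⟩ := F.nonzero
  have hprime : ∀ q, Prime q → ∃ i, ¬ q ∣ F.a i := fun q hq => by
    by_contra! h
    exact F.codim2 ⟨q, totalDegree_ne_zero_of_prime hq, h⟩
  obtain ⟨β, hβ⟩ := exists_coprime_combination F.a hprime hi₀
  have hα : ∑ i, (Pi.single i₀ 1 : Fin (n + 1) → MvPolynomial (Fin (n + 1)) ℂ) i * F.a i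
      = F.a i₀ := by
    simp [Pi.single_apply]
  obtain ⟨h, hI, hnot⟩ := exists_koszul_multiplier F.a (Pi.single i₀ 1) β
    (fun j k => pderiv j (F.a k) - pderiv k (F.a j)) (fun i j => by ring) F.integrable
    (by rwa [hα]) (by rwa [hα])
  rw [hα] at hI hnot
  set g := ∑ i, β i * F.a i
  have hnot : ¬ ∃ s t, h = F.a i₀ * s + g * t := fun hst => by
    obtain ⟨e, he⟩ := hnot hst
    obtain ⟨j, k, hjk⟩ := F.exists_curl_ne_zero
    apply hjk
    have hom : (pderiv j (F.a k) - pderiv k (F.a j)).IsHomogeneous d :=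
      ((F.homog k).pderiv).sub ((F.homog j).pderiv)
    ext m
    rw [coeff_zero]
    by_contra hm
    have hdeg := (DFunLike.congr_fun (Finsupp.degree_eq_weight_one (R := ℕ)) m).trans (hom hm)
    apply hm
    rw [he j k, coeff_sub, (F.homog j).coeff_mul_eq_zero _ _ (by omega),
      (F.homog k).coeff_mul_eq_zero _ _ (by omega), sub_zero]
  obtain ⟨p, hp, Θ, hΘ, hker⟩ := exists_surjective_to_free (F.homog i₀) hi₀
  have : Module.Free (MvPolynomial (Fin n) ℂ) (AdjoinRoot p) := hp.free_adjoinRoot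
  have : Module.Finite (MvPolynomial (Fin n) ℂ) (AdjoinRoot p) := hp.finite_adjoinRoot
  have hdvd : ∀ x, Θ g ∣ Θ x ↔ ∃ s t, x = F.a i₀ * s + g * t := fun x => by
    constructor
    · rintro ⟨y, hy⟩
      obtain ⟨t, rfl⟩ := hΘ y
      rw [← map_mul, ← sub_eq_zero, ← map_sub, hker] at hy
      obtain ⟨s, hs⟩ := hy
      exact ⟨s, t, by linear_combination hs⟩
    · rintro ⟨s, t, rfl⟩
      rw [map_add, map_mul, (hker _).2 dvd_rfl, zero_mul, zero_add, map_mul]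
      exact dvd_mul_right _ _
  have hg0 : Θ g ∈ nonZeroDivisors (AdjoinRoot p) := by
    rw [mem_nonZeroDivisors_iff_right]
    intro y hy
    obtain ⟨x, rfl⟩ := hΘ y
    rw [← map_mul, hker] at hy
    rw [hker]
    exact hβ x (by rwa [mul_comm])
  obtain ⟨Q, hQ, hQI, v, hv⟩ := exists_prime_two_free_variables hn hg0
    (h := Θ h) (by rwa [hdvd])
  refine ⟨Q.comap Θ, Ideal.IsPrime.comap Θ, fun i => hQI _ ?_, ?_⟩
  · rw [← map_mul, hdvd]
    exact hI i
  choose u hu using fun k => hΘ (algebraMap (MvPolynomial (Fin n) ℂ) (AdjoinRoot p) (X (v k)))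
  refine ⟨u, fun r hr => hv r ?_⟩
  rw [Ideal.mem_comap] at hr
  convert hr using 1
  have : (IsScalarTower.toAlgHom ℂ (MvPolynomial (Fin n) ℂ) (AdjoinRoot p)).comp (rename v) =
      Θ.comp (aeval u) := by
    ext k
    simp [hu]
  exact DFunLike.congr_fun this r

theorem ProjFoliation.exists_homogeneous_prime {n d : ℕ} (hn : 2 < n) (F : ProjFoliation n d) :
    ∃ P : Ideal (MvPolynomial (Fin (n + 1)) ℂ), P.IsPrime ∧ (∀ i, F.a i ∈ P) ∧
      (∀ p ∈ P, ∀ k, homogeneousComponent k p ∈ P) ∧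
      ∃ u : Fin 2 → MvPolynomial (Fin (n + 1)) ℂ,
        ∀ r : MvPolynomial (Fin 2) ℂ, aeval u r ∈ P → r = 0 := by
  classical
  obtain ⟨P, hP, hPa, u, hu⟩ := F.exists_prime hn
  let : GradedAlgebra (homogeneousSubmodule (Fin (n + 1)) ℂ) := MvPolynomial.gradedAlgebra
  let P' := P.homogeneousCore (homogeneousSubmodule (Fin (n + 1)) ℂ)
  have hle : P'.toIdeal ≤ P := Ideal.toIdeal_homogeneousCore_le _ _
  refine ⟨P'.toIdeal, hP.homogeneousCore, fun i => ?_, fun p hp k => ?_, u,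
    fun r hr => hu r (hle hr)⟩
  · exact Ideal.mem_homogeneousCore_of_homogeneous_of_mem ⟨d + 1, F.homog i⟩ (hPa i)
  · exact homogeneousComponent_mem_of_mem P'.isHomogeneous hp k

theorem MvPolynomial.IsHomogeneous.eval_smul {σ : Type*} [Fintype σ] {p : MvPolynomial σ ℂ} {k : ℕ}
    (hp : p.IsHomogeneous k) (c : ℂ) (z : σ → ℂ) : eval (c • z) p = c ^ k * eval z p := by
  rw [eval_eq', eval_eq', Finset.mul_sum]
  refine Finset.sum_congr rfl fun m hm => ?_
  have h1 := (DFunLike.congr_fun (Finsupp.degree_eq_weight_one (R := ℕ)) m).trans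
    (hp (mem_support_iff.1 hm))
  rw [Finsupp.degree_eq_sum] at h1
  rw [← h1, ← Finset.prod_pow_eq_pow_sum]
  simp only [Pi.smul_apply, smul_eq_mul, mul_pow, Finset.prod_mul_distrib]
  ring

theorem MvPolynomial.eval_smul_eq_zero_of_mem {σ : Type*} [Fintype σ]
    {P : Ideal (MvPolynomial σ ℂ)} (hP : ∀ p ∈ P, ∀ k, homogeneousComponent k p ∈ P)
    {z : σ → ℂ} (hz : ∀ p ∈ P, eval z p = 0) (c : ℂ) : ∀ p ∈ P, eval (c • z) p = 0 := by
  intro p hp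
  rw [← sum_homogeneousComponent p, map_sum]
  refine Finset.sum_eq_zero fun k _ => ?_
  rw [(homogeneousComponent_isHomogeneous k p).eval_smul, hz _ (hP p hp k), mul_zero]

theorem exists_point_of_isIntegral {σ κ A : Type*} [Finite σ] [CommRing A] [IsDomain A]
    (μ : MvPolynomial σ ℂ →+* A) (hμ : Function.Surjective μ)
    (Y : κ → MvPolynomial σ ℂ) (q : MvPolynomial σ ℂ)
    (Φ : Polynomial (MvPolynomial κ ℂ) →+* A)
    (hΦC : ∀ c, Φ (Polynomial.C (C c)) = μ (C c))
    (hΦY : ∀ i, Φ (Polynomial.C (X i)) = μ (Y i))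
    (hΦX : Φ Polynomial.X = μ q)
    (hΦ_int : Φ.IsIntegral) (x : κ → ℂ) (τ : ℂ)
    (hker : ∀ p, Φ p = 0 → (p.map (eval x)).eval τ = 0) :
    ∃ z, (∀ p, μ p = 0 → eval z p = 0) ∧ (∀ i, eval z (Y i) = x i) ∧ eval z q = τ := by
  let φ : Polynomial (MvPolynomial κ ℂ) →+* ℂ :=
    (Polynomial.evalRingHom τ).comp (Polynomial.mapRingHom (eval x))
  have hφ : Function.Surjective φ := fun c => ⟨Polynomial.C (C c), by simp [φ]⟩
  have hM : (RingHom.ker φ).IsMaximal := RingHom.ker_isMaximal_of_surjective φ hφ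
  let _ := Φ.toAlgebra
  have : Algebra.IsIntegral (Polynomial (MvPolynomial κ ℂ)) A := ⟨hΦ_int⟩
  obtain ⟨Q, -, hQ, hQM⟩ := Ideal.exists_ideal_over_prime_of_isIntegral (RingHom.ker φ)
    (⊥ : Ideal A) (fun p hp => hker p hp)
  have hQmax : Q.IsMaximal :=
    Ideal.isMaximal_of_isIntegral_of_isMaximal_comap Q (by rw [hQM]; exact hM)
  have hmax : (Q.comap μ).IsMaximal := Ideal.comap_isMaximal_of_surjective _ hμ
  obtain ⟨z, hz⟩ := isMaximal_iff_eq_vanishingIdeal_singleton.1 hmax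
  have hmem : ∀ p, μ p ∈ Q → eval z p = 0 := fun p hp => by
    have : p ∈ Q.comap μ := hp
    rw [hz, mem_vanishingIdeal_singleton_iff] at this
    simpa [aeval_eq_eval] using this
  have hmem' : ∀ p, φ p = 0 → Φ p ∈ Q := fun p hp => by
    have : p ∈ Q.comap (algebraMap _ _) := by rw [hQM]; exact hp
    exact this
  refine ⟨z, fun p hp => hmem p (by rw [hp]; exact Q.zero_mem), fun i => ?_, ?_⟩
  · have := hmem' (Polynomial.C (X i) - Polynomial.C (C (x i))) (by simp [φ])
    rw [map_sub, hΦC, hΦY, ← map_sub] at this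
    simpa [sub_eq_zero] using hmem _ this
  · have := hmem' (Polynomial.X - Polynomial.C (C τ)) (by simp [φ])
    rw [map_sub, hΦC, hΦX, ← map_sub] at this
    simpa [sub_eq_zero] using hmem _ this

theorem two_le_of_finite_of_algebraicIndependent {k : ℕ} {A : Type*} [CommRing A] [IsDomain A]
    [Algebra ℂ A] [Algebra (MvPolynomial (Fin k) ℂ) A]
    [IsScalarTower ℂ (MvPolynomial (Fin k) ℂ) A] [Module.Finite (MvPolynomial (Fin k) ℂ) A]
    [FaithfulSMul (MvPolynomial (Fin k) ℂ) A] {v : Fin 2 → A} (hv : AlgebraicIndependent ℂ v) :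
    2 ≤ k := by
  have h2 := hv.lift_cardinalMk_le_trdeg
  have h3 := lift_trdeg_add_eq ℂ (MvPolynomial (Fin k) ℂ) A
  rw [trdeg_eq_zero (R := MvPolynomial (Fin k) ℂ), MvPolynomial.trdeg_of_isDomain] at h3
  simp at h2 h3
  rw [← h3] at h2
  exact_mod_cast h2

theorem exists_monic_roots_eq_fiber {k : ℕ} {σ A : Type*} [Finite σ] [CommRing A] [IsDomain A]
    [Algebra ℂ A] [Algebra (MvPolynomial (Fin k) ℂ) A]
    [IsScalarTower ℂ (MvPolynomial (Fin k) ℂ) A] [Module.Finite (MvPolynomial (Fin k) ℂ) A]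
    [FaithfulSMul (MvPolynomial (Fin k) ℂ) A] (μ : MvPolynomial σ ℂ →ₐ[ℂ] A)
    (hμ : Function.Surjective μ) (Y : Fin k → MvPolynomial σ ℂ)
    (hY : ∀ i, μ (Y i) = algebraMap (MvPolynomial (Fin k) ℂ) A (X i)) (q : MvPolynomial σ ℂ) :
    ∃ m : Polynomial (MvPolynomial (Fin k) ℂ), m.Monic ∧
      m.natDegree ≤ (⊤ : Submodule (MvPolynomial (Fin k) ℂ) A).spanFinrank ∧
      ∀ x τ, (m.map (eval x)).eval τ = 0 ↔
        ∃ z, (∀ p, μ p = 0 → eval z p = 0) ∧ (∀ i, eval z (Y i) = x i) ∧ eval z q = τ := by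
  have hqi : IsIntegral (MvPolynomial (Fin k) ℂ) (μ q) := Algebra.IsIntegral.isIntegral _
  have halgC : ∀ c, algebraMap (MvPolynomial (Fin k) ℂ) A (C c) = μ (C c) := fun c => by
    rw [algHom_C]
    exact (IsScalarTower.algebraMap_apply ℂ (MvPolynomial (Fin k) ℂ) A c).symm
  refine ⟨minpoly (MvPolynomial (Fin k) ℂ) (μ q), minpoly.monic hqi, ?_,
    fun x τ => ⟨fun h => ?_, ?_⟩⟩
  · obtain ⟨p, hp, hdeg, hp0⟩ := LinearMap.exists_monic_and_natDegree_eq_and_aeval_eq_zero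
      (MvPolynomial (Fin k) ℂ) (Algebra.lmul (MvPolynomial (Fin k) ℂ) A (μ q))
    have hp1 : Polynomial.aeval (μ q) p = 0 := by
      rw [Polynomial.aeval_algHom_apply] at hp0
      simpa using DFunLike.congr_fun hp0 (1 : A)
    rw [← hdeg]
    exact Polynomial.natDegree_le_of_dvd (minpoly.isIntegrallyClosed_dvd hqi hp1) hp.ne_zero
  · refine exists_point_of_isIntegral μ.toRingHom hμ Y q
      (Polynomial.aeval (μ q)).toRingHom (fun c => ?_) (fun i => ?_) ?_ ?_ x τ fun p hp => ?_
    · exact (Polynomial.aeval_C _ _).trans (halgC c)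
    · exact (Polynomial.aeval_C _ _).trans (hY i).symm
    · exact Polynomial.aeval_X _
    · intro a
      obtain ⟨p, hp, hpa⟩ := Algebra.IsIntegral.isIntegral (R := MvPolynomial (Fin k) ℂ) a
      refine ⟨p.map Polynomial.C, hp.map _, ?_⟩
      rw [Polynomial.eval₂_map]
      have : (Polynomial.aeval (μ q)).toRingHom.comp Polynomial.C =
          algebraMap (MvPolynomial (Fin k) ℂ) A := RingHom.ext fun b => Polynomial.aeval_C _ b
      rw [this]
      exact hpa
    · obtain ⟨r, rfl⟩ := minpoly.isIntegrallyClosed_dvd hqi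
        (show Polynomial.aeval (μ q) p = 0 from hp)
      rw [Polynomial.map_mul, Polynomial.eval_mul, h, zero_mul]
  · rintro ⟨z, hzP, hzY, rfl⟩
    let ε : A →+* ℂ := (μ.toRingHom.liftOfSurjective hμ) ⟨eval z, hzP⟩
    have hε' : ∀ p, ε (μ p) = eval z p := fun p =>
      RingHom.liftOfRightInverse_comp_apply _ _ _ ⟨eval z, hzP⟩ p
    have hε : ε.comp (algebraMap (MvPolynomial (Fin k) ℂ) A) = eval x := by
      refine MvPolynomial.ringHom_ext (fun c => ?_) fun i => ?_
      · rw [RingHom.comp_apply, halgC, hε', eval_C, eval_C]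
      · rw [RingHom.comp_apply, ← hY, hε', hzY, eval_X]
    have h := congrArg ε (minpoly.aeval (MvPolynomial (Fin k) ℂ) (μ q))
    rw [map_zero, Polynomial.aeval_def, Polynomial.hom_eval₂, hε, hε'] at h
    rw [Polynomial.eval_map]
    exact h

theorem exists_noether_projection {σ : Type*} [Finite σ] {P : Ideal (MvPolynomial σ ℂ)}
    [hP : P.IsPrime] {u : Fin 2 → MvPolynomial σ ℂ}
    (hu : ∀ r : MvPolynomial (Fin 2) ℂ, aeval u r ∈ P → r = 0) :
    ∃ k, 2 ≤ k ∧ ∃ (Y : Fin k → MvPolynomial σ ℂ) (D : ℕ), ∀ q : MvPolynomial σ ℂ,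
      ∃ m : Polynomial (MvPolynomial (Fin k) ℂ), m.Monic ∧ m.natDegree ≤ D ∧
        ∀ x τ, (m.map (eval x)).eval τ = 0 ↔
          ∃ z, (∀ p ∈ P, eval z p = 0) ∧ (∀ i, eval z (Y i) = x i) ∧ eval z q = τ := by
  obtain ⟨A, _, _, _, μ, hμ, hker⟩ : ∃ (A : Type _) (_ : CommRing A) (_ : IsDomain A)
      (_ : Algebra ℂ A) (μ : MvPolynomial σ ℂ →ₐ[ℂ] A), Function.Surjective μ ∧
      ∀ p, μ p = 0 ↔ p ∈ P :=
    ⟨MvPolynomial σ ℂ ⧸ P, inferInstance, inferInstance, inferInstance, Ideal.Quotient.mkₐ ℂ P,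
      Ideal.Quotient.mkₐ_surjective ℂ P, fun p => Ideal.Quotient.eq_zero_iff_mem⟩
  have : Algebra.FiniteType ℂ A := Algebra.FiniteType.of_surjective μ hμ
  obtain ⟨k, g, hg, hgf⟩ := exists_finite_inj_algHom_of_fg ℂ A
  let _ : Algebra (MvPolynomial (Fin k) ℂ) A := g.toRingHom.toAlgebra
  have : IsScalarTower ℂ (MvPolynomial (Fin k) ℂ) A :=
    IsScalarTower.of_algebraMap_eq fun c => (g.commutes c).symm
  have : Module.Finite (MvPolynomial (Fin k) ℂ) A := hgf
  have : FaithfulSMul (MvPolynomial (Fin k) ℂ) A := (faithfulSMul_iff_algebraMap_injective _ _).2 hg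
  choose Y hY using fun i => hμ (algebraMap (MvPolynomial (Fin k) ℂ) A (X i))
  refine ⟨k, ?_, Y, (⊤ : Submodule (MvPolynomial (Fin k) ℂ) A).spanFinrank, fun q => ?_⟩
  · refine two_le_of_finite_of_algebraicIndependent (A := A) (v := fun i => μ (u i)) ?_
    rw [algebraicIndependent_iff]
    intro r hr
    refine hu r ((hker _).1 ?_)
    have : μ.comp (aeval u) = aeval fun i => μ (u i) := by ext; simp
    rw [← hr, ← this, AlgHom.comp_apply]
  · simpa only [hker] using exists_monic_roots_eq_fiber μ hμ Y hY q

theorem Multiset.pow_card_le_prod_of_nonneg {c : ℝ} (hc : 0 ≤ c) {s : Multiset ℝ}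
    (h : ∀ x ∈ s, c ≤ x) : c ^ s.card ≤ s.prod := by
  induction s using Multiset.induction_on with
  | empty => simp
  | cons a s ih =>
    rw [Multiset.card_cons, Multiset.prod_cons, pow_succ']
    have ha := h a (Multiset.mem_cons_self a s)
    exact mul_le_mul ha (ih fun x hx => h x (Multiset.mem_cons_of_mem hx)) (pow_nonneg hc _)
      (hc.trans ha)

theorem Multiset.prod_le_pow_card_of_nonneg {K : ℝ} {s : Multiset ℝ}
    (h0 : ∀ x ∈ s, 0 ≤ x) (h : ∀ x ∈ s, x ≤ K) : s.prod ≤ K ^ s.card := by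
  induction s using Multiset.induction_on with
  | empty => simp
  | cons a s ih =>
    rw [Multiset.card_cons, Multiset.prod_cons, pow_succ']
    have h0' : ∀ x ∈ s, 0 ≤ x := fun x hx => h0 x (Multiset.mem_cons_of_mem hx)
    exact mul_le_mul (h a (Multiset.mem_cons_self a s))
      (ih h0' fun x hx => h x (Multiset.mem_cons_of_mem hx)) (Multiset.prod_nonneg h0')
      ((h0 a (Multiset.mem_cons_self a s)).trans (h a (Multiset.mem_cons_self a s)))

/-- The polynomial map `Y` restricts to a finite surjective map `Z → ℂᵏ` of degree at most `D`, in
the sense that the values of each polynomial on the fibres are the roots of a monic polynomial. -/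
def IsFiniteProjection {σ : Type*} {k : ℕ} (Z : Set (σ → ℂ)) (Y : Fin k → MvPolynomial σ ℂ)
    (D : ℕ) : Prop :=
  ∀ q : MvPolynomial σ ℂ, ∃ m : Polynomial (MvPolynomial (Fin k) ℂ), m.Monic ∧ m.natDegree ≤ D ∧
    ∀ x τ, (m.map (eval x)).eval τ = 0 ↔ ∃ z ∈ Z, (∀ i, eval z (Y i) = x i) ∧ eval z q = τ

namespace IsFiniteProjection

variable {σ : Type*} {k : ℕ} {Z : Set (σ → ℂ)} {Y : Fin k → MvPolynomial σ ℂ} {D : ℕ}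

theorem finite_fiber [Finite σ] (h : IsFiniteProjection Z Y D) (x : Fin k → ℂ) :
    {z ∈ Z | ∀ i, eval z (Y i) = x i}.Finite := by
  choose m hm _ hroot using fun s : σ => h (X s)
  refine (Set.Finite.pi' (t := fun s => {τ : ℂ | ((m s).map (eval x)).IsRoot τ})
    fun s => Polynomial.finite_setOfPred_isRoot ((hm s).map _).ne_zero).subset ?_
  rintro z ⟨hz, hzx⟩ s
  exact (hroot s x (z s)).2 ⟨z, hz, hzx, by simp⟩

theorem isBounded_preimage [Fintype σ] (h : IsFiniteProjection Z Y D) {K : Set (Fin k → ℂ)}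
    (hK : IsCompact K) : Bornology.IsBounded {z ∈ Z | (fun i => eval z (Y i)) ∈ K} := by
  choose m hm _ hroot using fun s : σ => h (X s)
  have hbd : ∀ s, ∃ C : ℝ, ∀ z ∈ Z, (fun i => eval z (Y i)) ∈ K → ‖z s‖ ≤ C := by
    intro s
    have hc : ∀ i, ∃ C : NNReal, ∀ x ∈ K, ‖eval x ((m s).coeff i)‖₊ ≤ C := by
      intro i
      obtain ⟨C, hC⟩ := hK.exists_bound_of_continuousOn
        (MvPolynomial.continuous_eval ((m s).coeff i)).continuousOn
      exact ⟨C.toNNReal, fun x hx => by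
        rw [← NNReal.coe_le_coe, coe_nnnorm]
        exact (hC x hx).trans (Real.le_coe_toNNReal C)⟩
    choose C hC using hc
    refine ⟨((Finset.range (m s).natDegree).sup C + 1 : NNReal), fun z hz hzK => ?_⟩
    have hr : ((m s).map (eval fun i => eval z (Y i))).IsRoot (z s) :=
      (hroot s _ (z s)).2 ⟨z, hz, fun i => rfl, by simp⟩
    have := hr.norm_lt_cauchyBound ((hm s).map _).ne_zero
    rw [← coe_nnnorm, NNReal.coe_le_coe]
    refine this.le.trans ?_
    rw [Polynomial.cauchyBound, ((hm s).map _).leadingCoeff, (hm s).natDegree_map]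
    simp only [nnnorm_one, div_one, Polynomial.coeff_map]
    gcongr with i hi
    exact hC i _ hzK
  choose C hC using hbd
  refine (Metric.isBounded_closedBall (x := (0 : σ → ℂ)) (r := ∑ s, |C s|)).subset ?_
  rintro z ⟨hz, hzK⟩
  rw [mem_closedBall_zero_iff, pi_norm_le_iff_of_nonneg (by positivity)]
  intro s
  exact ((hC s z hz hzK).trans (le_abs_self _)).trans
    (Finset.single_le_sum (f := fun s => |C s|) (fun _ _ => abs_nonneg _) (Finset.mem_univ s))

theorem isCompact_preimage [Fintype σ] (h : IsFiniteProjection Z Y D) (hZ : IsClosed Z)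
    {K : Set (Fin k → ℂ)} (hK : IsCompact K) :
    IsCompact {z ∈ Z | (fun i => eval z (Y i)) ∈ K} := by
  refine Metric.isCompact_of_isClosed_isBounded ?_ (h.isBounded_preimage hK)
  exact hZ.inter (hK.isClosed.preimage
    (continuous_pi fun i => MvPolynomial.continuous_eval (Y i)))

/-- A minimum principle for polynomials without zeros on `Z`, over a disc in `ℂᵏ`. -/
theorem pow_le_norm_eval_mul_pow (h : IsFiniteProjection Z Y D) {x : ℂ → Fin k → ℂ}
    (hx : ∀ p : MvPolynomial (Fin k) ℂ, Differentiable ℂ fun s => eval (x s) p)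
    {r c K : ℝ} (hr : 0 < r) (hc : 0 < c) (hc1 : c ≤ 1) (hK : 1 ≤ K) (q : MvPolynomial σ ℂ)
    (hq : ∀ s, ‖s‖ ≤ r → ∀ z ∈ Z, (∀ i, eval z (Y i) = x s i) → eval z q ≠ 0)
    (hqc : ∀ s, ‖s‖ = r → ∀ z ∈ Z, (∀ i, eval z (Y i) = x s i) → c ≤ ‖eval z q‖)
    (hqK : ∀ z ∈ Z, (∀ i, eval z (Y i) = x 0 i) → ‖eval z q‖ ≤ K)
    {z₀ : σ → ℂ} (hz₀ : z₀ ∈ Z) (hxz₀ : ∀ i, eval z₀ (Y i) = x 0 i) :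
    c ^ D ≤ ‖eval z₀ q‖ * K ^ D := by
  obtain ⟨m, hm, hmD, hroot⟩ := h q
  have hnorm : ∀ s, ‖eval (x s) (m.coeff 0)‖ = ((m.map (eval (x s))).roots.map fun t => ‖t‖).prod := by
    intro s
    have := (IsAlgClosed.splits (m.map (eval (x s)))).coeff_zero_eq_prod_roots_of_monic (hm.map _)
    rw [Polynomial.coeff_map] at this
    rw [this, norm_mul, norm_pow, norm_neg, norm_one, one_pow, one_mul]
    exact map_multiset_prod (normHom : ℂ →*₀ ℝ) _
  have hcard : ∀ s, (m.map (eval (x s))).roots.card = m.natDegree := by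
    intro s
    rw [← (IsAlgClosed.splits (m.map (eval (x s)))).natDegree_eq_card_roots, hm.natDegree_map]
  have hmem : ∀ s, ∀ t ∈ (m.map (eval (x s))).roots,
      ∃ z ∈ Z, (∀ i, eval z (Y i) = x s i) ∧ eval z q = t := fun s t ht =>
    (hroot _ _).1 (Polynomial.isRoot_of_mem_roots ht)
  have hne : ∀ s, ‖s‖ ≤ r → eval (x s) (m.coeff 0) ≠ 0 := by
    intro s hs h0
    obtain ⟨z, hz, hzx, hzq⟩ := (hroot (x s) 0).1
      (by rwa [← Polynomial.coeff_zero_eq_eval_zero, Polynomial.coeff_map])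
    exact hq s hs z hz hzx hzq
  have hbdry : ∀ s, ‖s‖ = r → c ^ D ≤ ‖eval (x s) (m.coeff 0)‖ := by
    intro s hs
    rw [hnorm]
    refine (pow_le_pow_of_le_one hc.le hc1 hmD).trans ?_
    rw [← hcard s, ← Multiset.card_map (fun t : ℂ => ‖t‖)]
    refine Multiset.pow_card_le_prod_of_nonneg hc.le ?_
    intro a ha
    obtain ⟨t, ht, rfl⟩ := Multiset.mem_map.1 ha
    obtain ⟨z, hz, hzx, rfl⟩ := hmem s t ht
    exact hqc s hs z hz hzx
  have hcenter : ‖eval (x 0) (m.coeff 0)‖ ≤ ‖eval z₀ q‖ * K ^ D := by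
    have hmz : eval z₀ q ∈ (m.map (eval (x 0))).roots :=
      (Polynomial.mem_roots ((hm.map _).ne_zero)).2 ((hroot _ _).2 ⟨z₀, hz₀, hxz₀, rfl⟩)
    obtain ⟨R, hR⟩ := Multiset.exists_cons_of_mem hmz
    rw [hnorm, hR, Multiset.map_cons, Multiset.prod_cons]
    gcongr
    have hRD : R.card ≤ D := by
      have := hcard 0
      rw [hR, Multiset.card_cons] at this
      omega
    refine le_trans ?_ (pow_le_pow_right₀ hK hRD)
    rw [← Multiset.card_map (fun t : ℂ => ‖t‖)]
    refine Multiset.prod_le_pow_card_of_nonneg ?_ ?_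
    · intro a ha
      obtain ⟨t, ht, rfl⟩ := Multiset.mem_map.1 ha
      exact norm_nonneg _
    · intro a ha
      obtain ⟨t, ht, rfl⟩ := Multiset.mem_map.1 ha
      obtain ⟨z, hz, hzx, rfl⟩ := hmem 0 t (by rw [hR]; exact Multiset.mem_cons_of_mem ht)
      exact hqK z hz hzx
  have hmax : ‖(eval (x 0) (m.coeff 0))⁻¹‖ ≤ (c ^ D)⁻¹ := by
    refine Complex.norm_le_of_forall_mem_frontier_norm_le (f := fun s => (eval (x s) (m.coeff 0))⁻¹)
      (Metric.isBounded_ball (x := (0 : ℂ)) (r := r)) ?_ ?_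
      (subset_closure (Metric.mem_ball_self hr))
    · refine DifferentiableOn.diffContOnCl fun s hs => ?_
      rw [closure_ball _ hr.ne', mem_closedBall_zero_iff] at hs
      exact ((hx _ s).inv (hne s hs)).differentiableWithinAt
    · intro s hs
      rw [frontier_ball _ hr.ne', mem_sphere_zero_iff_norm] at hs
      rw [norm_inv]
      exact inv_anti₀ (by positivity) (hbdry s hs)
  rw [norm_inv, inv_le_inv₀ (norm_pos_iff.2 (hne 0 (by simpa using hr.le))) (by positivity)] at hmax
  exact hmax.trans hcenter

end IsFiniteProjection

theorem norm_smoothstep_le {u : ℂ} {e : ℝ} (he : e ≤ 1 / 8) (hu : ‖u‖ ≤ e) :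
    ‖3 * u ^ 2 - 2 * u ^ 3‖ ≤ e / 2 := by
  have h0 := norm_nonneg u
  have h1 : ‖3 * u ^ 2 - 2 * u ^ 3‖ ≤ 3 * ‖u‖ ^ 2 + 2 * ‖u‖ ^ 3 := by
    refine (norm_sub_le _ _).trans (le_of_eq ?_)
    simp
  have h2 : ‖u‖ ^ 2 ≤ e * (1 / 8) := by 
    rw [pow_two]; exact mul_le_mul hu (hu.trans he) h0 (h0.trans hu)
  have h3 : ‖u‖ ^ 3 ≤ e * (1 / 8) * (1 / 8) := by
    
    rw [pow_succ]; exact mul_le_mul h2 (hu.trans he) h0 (by linarith [h0.trans hu])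
  linarith [h0.trans hu]

theorem MvPolynomial.exists_approx_indicator {σ : Type*} (a : MvPolynomial σ ℂ) (m : ℕ) :
    ∃ χ : MvPolynomial σ ℂ, ∀ z, (‖eval z a‖ ≤ 1 / 8 → ‖eval z χ‖ ≤ (1 / 8) * (1 / 2) ^ m) ∧
      (‖1 - eval z a‖ ≤ 1 / 8 → ‖1 - eval z χ‖ ≤ (1 / 8) * (1 / 2) ^ m) := by
  induction m with
  | zero => exact ⟨a, fun z => by simp⟩
  | succ m ih =>
    obtain ⟨χ, hχ⟩ := ih
    have he : (1 / 8 : ℝ) * (1 / 2) ^ m ≤ 1 / 8 :=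
      mul_le_of_le_one_right (by norm_num) (pow_le_one₀ (by norm_num) (by norm_num))
    have he' : (1 / 8 : ℝ) * (1 / 2) ^ (m + 1) = (1 / 8) * (1 / 2) ^ m / 2 := by ring
    have hev : ∀ z, eval z (C 3 * χ ^ 2 - C 2 * χ ^ 3) = 3 * eval z χ ^ 2 - 2 * eval z χ ^ 3 := by
      simp
    refine ⟨C 3 * χ ^ 2 - C 2 * χ ^ 3, fun z => ⟨fun h => ?_, fun h => ?_⟩⟩
    · rw [hev, he']
      exact norm_smoothstep_le he ((hχ z).1 h)
    · rw [hev, he', show 1 - (3 * eval z χ ^ 2 - 2 * eval z χ ^ 3) =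
        3 * (1 - eval z χ) ^ 2 - 2 * (1 - eval z χ) ^ 3 by ring]
      exact norm_smoothstep_le he ((hχ z).2 h)

theorem MvPolynomial.exists_eval_eq_one_of_notMem {σ : Type*} {z₀ : σ → ℂ} {S : Set (σ → ℂ)}
    (hS : S.Finite) (hz₀ : z₀ ∉ S) :
    ∃ a : MvPolynomial σ ℂ, eval z₀ a = 1 ∧ ∀ z ∈ S, eval z a = 0 := by
  have : ∀ z : S, ∃ s, z₀ s ≠ z.1 s := fun z =>
    Function.ne_iff.1 fun h => hz₀ (h ▸ z.2)
  choose s hs using this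
  have := hS.fintype
  refine ⟨∏ z : S, C (z₀ (s z) - z.1 (s z))⁻¹ * (X (s z) - C (z.1 (s z))), ?_, fun z hz => ?_⟩
  · rw [map_prod]
    refine Finset.prod_eq_one fun z _ => ?_
    simp only [map_mul, map_sub, eval_C, eval_X]
    exact inv_mul_cancel₀ (sub_ne_zero.2 (hs z))
  · rw [map_prod]
    exact Finset.prod_eq_zero (Finset.mem_univ ⟨z, hz⟩) (by simp)

theorem MvPolynomial.finite_setOf_eval_smul_eq {σ : Type*} (p : MvPolynomial σ ℂ) (z : σ → ℂ)
    {c : ℂ} (hc : ∃ t : ℂ, eval (t • z) p ≠ c) : {t : ℂ | eval (t • z) p = c}.Finite := by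
  let Q : Polynomial ℂ := aeval (fun s => Polynomial.C (z s) * Polynomial.X) p - Polynomial.C c
  have hQ : ∀ t, Q.eval t = eval (t • z) p - c := by
    intro t
    have : ∀ p : MvPolynomial σ ℂ,
        (aeval (fun s => Polynomial.C (z s) * Polynomial.X) p : Polynomial ℂ).eval t =
          eval (t • z) p := by
      intro p
      induction p using MvPolynomial.induction_on with
      | C a => simp
      | add p q hp hq => simp [hp, hq]
      | mul_X p i hp => simp [hp]; left; ring
    simp [Q, this]
  have hQ0 : Q ≠ 0 := by
    rintro h
    obtain ⟨t, ht⟩ := hc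
    have := hQ t
    rw [h, Polynomial.eval_zero] at this
    exact ht (sub_eq_zero.1 this.symm)
  refine (Polynomial.finite_setOfPred_isRoot hQ0).subset fun t ht => ?_
  change Q.eval t = 0
  rw [hQ, sub_eq_zero]
  exact ht

theorem IsCompact.exists_pos_forall_le {α : Type*} [TopologicalSpace α] {K : Set α}
    (hK : IsCompact K) {f : α → ℝ} (hf : ContinuousOn f K) (h0 : ∀ z ∈ K, 0 < f z) :
    ∃ δ > 0, ∀ z ∈ K, δ ≤ f z := by
  rcases K.eq_empty_or_nonempty with rfl | hne
  · exact ⟨1, one_pos, by simp⟩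
  · obtain ⟨z, hz, hmin⟩ := hK.exists_isMinOn hne hf
    exact ⟨f z, h0 z hz, fun w hw => hmin hw⟩

namespace IsFiniteProjection

variable {σ : Type*} {k : ℕ} {Z : Set (σ → ℂ)} {Y : Fin k → MvPolynomial σ ℂ} {D : ℕ}

theorem exists_eval_smul_ne [Finite σ] (h : IsFiniteProjection Z Y D) {z₀ : σ → ℂ} (hz₀ : z₀ ≠ 0)
    (hline : ∀ t : ℂ, t • z₀ ∈ Z) : ∃ i, ∃ t : ℂ, eval (t • z₀) (Y i) ≠ eval z₀ (Y i) := by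
  by_contra! hcon
  refine Set.infinite_range_of_injective (smul_left_injective ℂ hz₀)
    ((h.finite_fiber fun i => eval z₀ (Y i)).subset ?_)
  rintro _ ⟨t, rfl⟩
  exact ⟨hline t, fun i => hcon i t⟩

/-- A point of a fibre of `Z → ℂᵏ` has small neighbourhoods over discs that are separated from the
rest of the fibre. -/
theorem exists_disc_separated [Fintype σ] (h : IsFiniteProjection Z Y D) (hZ : IsClosed Z)
    {N : Set (σ → ℂ)} (hN : IsOpen N) (y : Fin k → ℂ) (j : Fin k)
    (hfib : ∀ z ∈ Z, (∀ i, eval z (Y i) = y i) → z ∈ N) :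
    ∃ r > 0, IsCompact {z ∈ Z | ∃ s : ℂ, ‖s‖ ≤ r ∧ ∀ i, eval z (Y i) = Function.update y j (y j + s) i} ∧
      {z ∈ Z | ∃ s : ℂ, ‖s‖ ≤ r ∧ ∀ i, eval z (Y i) = Function.update y j (y j + s) i} ⊆ N := by
  have hcomp : ∀ r : ℝ, IsCompact
      {z ∈ Z | ∃ s : ℂ, ‖s‖ ≤ r ∧ ∀ i, eval z (Y i) = Function.update y j (y j + s) i} := by
    intro r
    have hc : Continuous fun s : ℂ => Function.update y j (y j + s) :=
      continuous_const.update j (continuous_const.add continuous_id)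
    convert h.isCompact_preimage hZ ((isCompact_closedBall (0 : ℂ) r).image hc) using 3 with z
    simp only [Set.mem_image, mem_closedBall_zero_iff, funext_iff]
    exact and_congr_right fun _ => exists_congr fun s => and_congr_right fun _ =>
      forall_congr' fun i => eq_comm
  obtain ⟨δ, hδ, hmin⟩ := ((hcomp 1).diff hN).exists_pos_forall_le
    (f := fun z => ‖eval z (Y j) - y j‖)
    ((MvPolynomial.continuous_eval (Y j)).sub continuous_const).norm.continuousOn (by
      rintro z ⟨⟨hz, s, hs, hzs⟩, hzN⟩
      rw [norm_pos_iff, hzs]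
      intro h0
      simp only [Function.update_self, add_sub_cancel_left] at h0
      subst h0
      exact hzN (hfib z hz (by simpa using hzs)))
  refine ⟨min 1 (δ / 2), by positivity, hcomp _, ?_⟩
  rintro z ⟨hz, s, hs, hzs⟩
  by_contra hzN
  have := hmin z ⟨⟨hz, s, hs.trans (min_le_left _ _), hzs⟩, hzN⟩
  rw [hzs] at this
  simp only [Function.update_self, add_sub_cancel_left] at this
  linarith [min_le_right 1 (δ / 2)]

theorem exists_zero_of_approx [Fintype σ] (h : IsFiniteProjection Z Y D) (hk : 2 ≤ k)
    (hZ : IsClosed Z) {z₀ : σ → ℂ} (hz₀ : z₀ ≠ 0) (hline : ∀ t : ℂ, t • z₀ ∈ Z) {ρ : ℝ}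
    (hρ : 0 < ρ) {g : (σ → ℂ) → ℂ} (hg : ContinuousOn g (Metric.closedBall z₀ ρ)) (hg0 : g z₀ = 0)
    (hgz : ∀ z ∈ Z, z ∈ Metric.closedBall z₀ ρ → g z = 0 → ∃ t : ℂ, z = t • z₀) :
    ∃ ε > 0, ∀ p : MvPolynomial σ ℂ, (∀ z ∈ Metric.closedBall z₀ ρ, ‖eval z p - g z‖ ≤ ε) →
      ∃ z ∈ Z, z ∈ Metric.closedBall z₀ ρ ∧ eval z p = 0 := by
  obtain ⟨i, hi⟩ := h.exists_eval_smul_ne hz₀ hline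
  have hTfin := MvPolynomial.finite_setOf_eval_smul_eq (Y i) z₀ hi
  have hz₀Z : z₀ ∈ Z := by simpa using hline 1
  obtain ⟨j, hij⟩ : ∃ j : Fin k, j ≠ i := by
    have : Nontrivial (Fin k) := Fin.nontrivial_iff_two_le.2 hk
    exact exists_ne i
  set y : Fin k → ℂ := fun l => eval z₀ (Y l) with hy
  have hfibfin := h.finite_fiber y
  set T : Set (σ → ℂ) := (fun t : ℂ => t • z₀) '' {t : ℂ | eval (t • z₀) (Y i) = eval z₀ (Y i)}
    with hT
  set S : Set (σ → ℂ) := {z ∈ Z | ∀ l, eval z (Y l) = y l} \ {z₀} with hS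
  have hSfin : S.Finite := hfibfin.subset Set.sdiff_subset
  have hTS : (T \ {z₀}).Finite := (hTfin.image _).subset Set.sdiff_subset
  obtain ⟨a, ha1, ha0⟩ := MvPolynomial.exists_eval_eq_one_of_notMem hSfin
    (z₀ := z₀) (fun h => h.2 rfl)
  set N' : Set (σ → ℂ) := (Metric.ball z₀ ρ ∩ (T \ {z₀})ᶜ) ∩ {z | ‖1 - eval z a‖ < 1 / 8} with hN'
  set N'' : Set (σ → ℂ) := {z | ‖eval z a‖ < 1 / 8} with hN''
  have hacont := MvPolynomial.continuous_eval a
  have hN'open : IsOpen N' := (Metric.isOpen_ball.inter hTS.isClosed.isOpen_compl).inter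
    (isOpen_lt (continuous_const.sub hacont).norm continuous_const)
  have hN''open : IsOpen N'' := isOpen_lt hacont.norm continuous_const
  obtain ⟨r, hr, hKc, hKN⟩ := h.exists_disc_separated hZ (hN'open.union hN''open) y j (by
    intro z hz hzy
    by_cases hzz : z = z₀
    · subst hzz
      left
      exact ⟨⟨Metric.mem_ball_self hρ, fun h => h.2 rfl⟩, by simp [ha1]⟩
    · right
      simp [hN'', ha0 z ⟨⟨hz, hzy⟩, hzz⟩])
  set K := {z ∈ Z | ∃ s : ℂ, ‖s‖ ≤ r ∧ ∀ i, eval z (Y i) = Function.update y j (y j + s) i} with hK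
  have hK'c : IsCompact (K \ N'') := hKc.diff hN''open
  have hK'N' : ∀ z ∈ K \ N'', z ∈ N' := fun z hz => (hKN hz.1).resolve_right hz.2
  have hK'B : K \ N'' ⊆ Metric.closedBall z₀ ρ := fun z hz =>
    Metric.ball_subset_closedBall (hK'N' z hz).1.1
  obtain ⟨δ, hδ, hδg⟩ : ∃ δ > 0, ∀ z ∈ K \ N'', ‖eval z (Y j) - y j‖ = r → δ ≤ ‖g z‖ := by
    have hclosed : IsClosed {z | ‖eval z (Y j) - y j‖ = r} := isClosed_eq
      ((MvPolynomial.continuous_eval (Y j)).sub continuous_const).norm continuous_const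
    obtain ⟨δ, hδ, h⟩ := (hK'c.inter_right hclosed).exists_pos_forall_le (f := fun z => ‖g z‖)
      ((hg.mono hK'B).mono Set.inter_subset_left).norm (by
        rintro z ⟨hz, hzr⟩
        rw [norm_pos_iff]
        intro hgz0
        obtain ⟨t, rfl⟩ := hgz z hz.1.1 (hK'B hz) hgz0
        obtain ⟨s, hs, hzs⟩ := hz.1.2
        have hti : eval (t • z₀) (Y i) = eval z₀ (Y i) := by
          rw [hzs i, Function.update_of_ne hij.symm]
        have hmem : t • z₀ ∈ T := ⟨t, hti, rfl⟩
        have heq : t • z₀ = z₀ := by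
          by_contra hne
          exact (hK'N' _ hz).1.2 ⟨hmem, hne⟩
        change ‖eval (t • z₀) (Y j) - y j‖ = r at hzr
        rw [heq, hy, sub_self, norm_zero] at hzr
        exact hr.ne hzr)
    exact ⟨δ, hδ, fun z hz hzr => h z ⟨hz, hzr⟩⟩
  set c : ℝ := min (δ / 2) (1 / 2) with hc
  have hcpos : 0 < c := by positivity
  have hc1 : c ≤ 1 := (min_le_right _ _).trans (by norm_num)
  set ε : ℝ := min (min (δ / 4) 1) (c ^ D / (4 * 2 ^ D)) with hε
  have hεpos : 0 < ε := by positivity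
  have hεδ : ε ≤ δ / 4 := (min_le_left _ _).trans (min_le_left _ _)
  have hε1 : ε ≤ 1 := (min_le_left _ _).trans (min_le_right _ _)
  have hεc : ε ≤ c ^ D / (4 * 2 ^ D) := min_le_right _ _
  refine ⟨ε, hεpos, fun p hp => ?_⟩
  by_contra! hne
  have hpcont := MvPolynomial.continuous_eval p
  obtain ⟨μ, hμ, hμp⟩ := hK'c.exists_pos_forall_le (f := fun z => ‖eval z p‖)
    hpcont.norm.continuousOn
    (fun z hz => norm_pos_iff.2 (hne z hz.1.1 (hK'B hz)))
  obtain ⟨L, hL⟩ := hKc.exists_bound_of_continuousOn (f := fun z => eval z p - 1)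
    (hpcont.sub continuous_const).continuousOn
  set η : ℝ := min (min (μ / 2) (1 / 2)) ε with hη
  have hηpos : 0 < η := by positivity
  have hημ : η ≤ μ / 2 := (min_le_left _ _).trans (min_le_left _ _)
  have hη2 : η ≤ 1 / 2 := (min_le_left _ _).trans (min_le_right _ _)
  have hηε : η ≤ ε := min_le_right _ _
  obtain ⟨m, hm⟩ := exists_pow_lt_of_lt_one (show 0 < η / (|L| + 1) by positivity)
    (show (1 / 2 : ℝ) < 1 by norm_num)
  obtain ⟨χ, hχ⟩ := MvPolynomial.exists_approx_indicator a m
  have hsmall : ∀ u v : ℂ, ‖u‖ ≤ (1 / 8) * (1 / 2) ^ m → ‖v‖ ≤ L → ‖u * v‖ ≤ η := by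
    intro u v hu hv
    rw [norm_mul]
    have h1 : ‖u‖ ≤ η / (|L| + 1) := by
      have : (0 : ℝ) ≤ (1 / 2) ^ m := by positivity
      linarith
    have h2 : ‖v‖ ≤ |L| + 1 := by linarith [le_abs_self L]
    calc ‖u‖ * ‖v‖ ≤ η / (|L| + 1) * (|L| + 1) := by gcongr
      _ = η := div_mul_cancel₀ _ (by positivity)
  set q : MvPolynomial σ ℂ := 1 + χ * (p - 1) with hq
  have hqe : ∀ z, eval z q = 1 + eval z χ * (eval z p - 1) := by simp [hq]
  have hq' : ∀ z ∈ K \ N'', ‖eval z q - eval z p‖ ≤ η := by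
    intro z hz
    rw [hqe, show 1 + eval z χ * (eval z p - 1) - eval z p =
      -((1 - eval z χ) * (eval z p - 1)) by ring, norm_neg]
    exact hsmall _ _ ((hχ z).2 (hK'N' z hz).2.le) (hL z hz.1)
  have hq'' : ∀ z ∈ K, z ∈ N'' → ‖eval z q - 1‖ ≤ η := by
    intro z hz hzN
    rw [hqe, add_sub_cancel_left]
    exact hsmall _ _ ((hχ z).1 (le_of_lt hzN)) (hL z hz)
  have hx0 : ∀ l, eval z₀ (Y l) = Function.update y j (y j + 0) l := by simp [hy]
  have hz₀K : z₀ ∈ K := ⟨hz₀Z, 0, by simpa using hr.le, hx0⟩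
  have hz₀N : z₀ ∉ N'' := by simp only [hN'', Set.mem_ofPred_eq, ha1]; norm_num
  have hqz₀ : ‖eval z₀ q‖ ≤ 2 * ε := by
    have h1 := hq' z₀ ⟨hz₀K, hz₀N⟩
    have h2 := hp z₀ (Metric.mem_closedBall_self hρ.le)
    rw [hg0, sub_zero] at h2
    have := norm_sub_norm_le (eval z₀ q) (eval z₀ p)
    linarith
  have hmain := h.pow_le_norm_eval_mul_pow (x := fun s => Function.update y j (y j + s)) (r := r) (c := c)
    (K := 2) (fun p s => by
      refine (AnalyticAt.aeval_mvPolynomial (A := ℂ) (f := fun s => Function.update y j (y j + s))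
        (fun l => ?_) p).differentiableAt
      by_cases hl : l = j
      · subst hl
        simp only [Function.update_self]
        fun_prop
      · simp only [Function.update_of_ne hl]
        fun_prop) hr hcpos hc1 (by norm_num) q ?_ ?_ ?_ hz₀Z hx0
  · have h4 : ε * (4 * 2 ^ D) ≤ c ^ D := (le_div_iff₀ (by positivity)).1 hεc
    have h5 : ‖eval z₀ q‖ * 2 ^ D ≤ 2 * ε * 2 ^ D := by gcongr
    have h6 : 0 < ε * 2 ^ D := by positivity
    linarith
  · intro s hs z hz hzs h0
    have hzK : z ∈ K := ⟨hz, s, hs, hzs⟩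
    by_cases hzN : z ∈ N''
    · have := hq'' z hzK hzN
      rw [h0, zero_sub, norm_neg, norm_one] at this
      linarith
    · have h1 := hq' z ⟨hzK, hzN⟩
      rw [h0, zero_sub, norm_neg] at h1
      have h2 : μ ≤ ‖eval z p‖ := hμp z ⟨hzK, hzN⟩
      linarith
  · intro s hs z hz hzs
    have hzK : z ∈ K := ⟨hz, s, hs.le, hzs⟩
    by_cases hzN : z ∈ N''
    · have h1 := hq'' z hzK hzN
      have h2 := norm_sub_norm_le 1 (eval z q)
      rw [norm_sub_rev, norm_one] at h2
      linarith [min_le_right (δ / 2) (1 / 2)]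
    · have h1 := hq' z ⟨hzK, hzN⟩
      have h2 := hp z (hK'B ⟨hzK, hzN⟩)
      have h3 : δ ≤ ‖g z‖ := hδg z ⟨hzK, hzN⟩ (by
        rw [hzs j, Function.update_self, add_sub_cancel_left, hs])
      have h4 := norm_sub_norm_le (g z) (eval z p)
      have h5 := norm_sub_norm_le (eval z p) (eval z q)
      rw [norm_sub_rev] at h4 h5
      linarith [min_le_left (δ / 2) (1 / 2)]
  · intro z hz hzs
    by_cases hzz : z = z₀
    · subst hzz
      linarith
    · have hzN : z ∈ N'' := by
        have : z ∈ S := ⟨⟨hz, by simpa using hzs⟩, hzz⟩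
        simp [hN'', ha0 z this]
      have h1 := hq'' z ⟨hz, 0, by simpa using hr.le, hzs⟩ hzN
      have h2 := norm_sub_norm_le (eval z q) 1
      rw [norm_one] at h2
      linarith

end IsFiniteProjection

theorem MvPolynomial.eval_aeval_eq {σ τ : Type*} (g : τ → MvPolynomial σ ℂ)
    (p : MvPolynomial τ ℂ) (z : σ → ℂ) : eval z (aeval g p) = eval (fun i => eval z (g i)) p := by
  induction p using MvPolynomial.induction_on with
  | C a => simp
  | add p q hp hq => simp only [map_add, hp, hq]
  | mul_X p i hp => simp only [map_mul, hp, aeval_X, eval_X]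

theorem MultilinearMap.exists_mvPolynomial_eval_eq {σ : Type*} [Fintype σ] {k : ℕ}
    (m : MultilinearMap ℂ (fun _ : Fin k => σ → ℂ) ℂ) :
    ∃ p : MvPolynomial σ ℂ, ∀ z, eval z p = m fun _ => z := by
  classical
  refine ⟨∑ φ : Fin k → σ, (∏ i, X (φ i)) * C (m fun i => Pi.single (φ i) 1), fun z => ?_⟩
  have hz : (fun _ : Fin k => z) = fun _ => ∑ s, z s • (Pi.single s 1 : σ → ℂ) := by
    funext _
    exact pi_eq_sum_univ' z
  rw [hz, MultilinearMap.map_sum]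
  simp [MultilinearMap.map_smul_univ, map_prod]

theorem AnalyticAt.exists_mvPolynomial_approx {σ : Type*} [Fintype σ] {f : (σ → ℂ) → ℂ}
    {w₀ : σ → ℂ} (hf : AnalyticAt ℂ f w₀) :
    ∃ R > 0, ∀ ε > 0, ∃ p : MvPolynomial σ ℂ, ∀ w ∈ Metric.ball w₀ R, ‖eval w p - f w‖ ≤ ε := by
  obtain ⟨P, r, hP⟩ := hf
  obtain ⟨R, hR0, hRr⟩ := ENNReal.lt_iff_exists_nnreal_btwn.1 hP.r_pos
  refine ⟨R, by simpa using hR0, fun ε hε => ?_⟩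
  have := Metric.tendstoUniformlyOn_iff.1 (hP.tendstoUniformlyOn' hRr) ε hε
  obtain ⟨N, hN⟩ := this.exists
  choose q hq using fun k => (P k).toMultilinearMap.exists_mvPolynomial_eval_eq
  refine ⟨aeval (fun i => X i - C (w₀ i)) (∑ k ∈ Finset.range N, q k), fun w hw => ?_⟩
  have h := hN w hw
  rw [dist_comm, dist_eq_norm] at h
  have he : eval w (aeval (fun i => X i - C (w₀ i)) (∑ k ∈ Finset.range N, q k) :
      MvPolynomial σ ℂ) = P.partialSum N (w - w₀) := by
    simp only [eval_aeval_eq, map_sub, eval_X, eval_C, FormalMultilinearSeries.partialSum, map_sum]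
    exact Finset.sum_congr rfl fun k _ => hq k (w - w₀)
  rw [he]
  exact h.le

theorem MvPolynomial.exists_eval_linearMap {σ : Type*} [Fintype σ] (p : MvPolynomial σ ℂ)
    (A : (σ → ℂ) →ₗ[ℂ] (σ → ℂ)) : ∃ q : MvPolynomial σ ℂ, ∀ z, eval z q = eval (A z) p := by
  classical
  refine ⟨aeval (fun i => ∑ s, X s * C (A (Pi.single s 1) i)) p, fun z => ?_⟩
  have hz : ∀ i, A z i = ∑ s, z s * A (Pi.single s 1) i := by
    intro i
    conv_lhs => rw [pi_eq_sum_univ' z, map_sum]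
    simp
  rw [eval_aeval_eq]
  congr 2
  funext i
  simp [hz]

theorem exists_equiv_inner_ne_zero {σ : Type*} [Fintype σ] {w z : σ → ℂ} (hw : w ≠ 0)
    (hz : z ≠ 0) : ∃ T : (σ → ℂ) ≃L[ℂ] EuclideanSpace ℂ σ, inner ℂ (T w) (T z) ≠ 0 := by
  let T₀ : (σ → ℂ) ≃L[ℂ] EuclideanSpace ℂ σ := (EuclideanSpace.equiv σ ℂ).symm
  by_cases h : inner ℂ (T₀ w) (T₀ z) = 0
  · let S : EuclideanSpace ℂ σ →ₗ[ℂ] EuclideanSpace ℂ σ :=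
      LinearMap.id + (innerₛₗ ℂ (T₀ w)).smulRight (T₀ z)
    have hS : ∀ u, S u = u + inner ℂ (T₀ w) u • T₀ z := fun u => by simp [S]
    have hinj : Function.Injective S := by
      rw [← LinearMap.ker_eq_bot, LinearMap.ker_eq_bot']
      intro u hu
      rw [hS] at hu
      have h1 : inner ℂ (T₀ w) (u + inner ℂ (T₀ w) u • T₀ z) = 0 := by rw [hu, inner_zero_right]
      rw [inner_add_right, inner_smul_right, h, mul_zero, add_zero] at h1
      rwa [h1, zero_smul, add_zero] at hu
    refine ⟨T₀.trans (LinearEquiv.ofInjectiveEndo S hinj).toContinuousLinearEquiv, ?_⟩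
    change inner ℂ (S (T₀ w)) (S (T₀ z)) ≠ 0
    rw [hS, hS, h, zero_smul, add_zero, inner_add_left, h, zero_add, inner_smul_left]
    simp [hw, hz]
  · exact ⟨T₀, h⟩

/-- Two closed cones that are not orthogonal to each other have a pair of closest directions. -/
theorem exists_closest_directions {E : Type*} [NormedAddCommGroup E] [InnerProductSpace ℂ E]
    [FiniteDimensional ℂ E] {Z M : Set E} (hZ : IsClosed Z) (hZc : ∀ t : ℂ, ∀ z ∈ Z, t • z ∈ Z)
    (hM : IsClosed (insert 0 M)) (hMc : ∀ t : ℂ, t ≠ 0 → ∀ w ∈ M, t • w ∈ M)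
    (hne : ∃ w ∈ M, ∃ z ∈ Z, inner ℂ w z ≠ 0) :
    ∃ z₀ ∈ Z, ‖z₀‖ = 1 ∧ ∃ w₀ ∈ M, ∀ z ∈ Z, ∀ w ∈ M, ‖w₀ - z₀‖ * ‖z‖ ≤ ‖w - z‖ := by
  have := FiniteDimensional.proper ℂ E
  obtain ⟨w₁, hw₁, z₁, hz₁, hwz⟩ := hne
  have hw0 : w₁ ≠ 0 := by rintro rfl; simp at hwz
  have hz0 : z₁ ≠ 0 := by rintro rfl; simp at hwz
  set S : Set (E × E) := {x | x.1 ∈ Z ∧ x.2 ∈ insert 0 M ∧ ‖x.1‖ = 1 ∧ ‖x.2 - x.1‖ ≤ 1} with hS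
  have hScl : IsClosed S := (hZ.preimage continuous_fst).inter ((hM.preimage continuous_snd).inter
    ((isClosed_eq continuous_fst.norm continuous_const).inter
      (isClosed_le (continuous_snd.sub continuous_fst).norm continuous_const)))
  have hSb : Bornology.IsBounded S := by
    refine (Metric.isBounded_closedBall (x := (0 : E × E)) (r := 2)).subset ?_
    rintro ⟨x, y⟩ ⟨-, -, h1, h2⟩
    rw [mem_closedBall_zero_iff, Prod.norm_mk]
    refine max_le (by simp only at h1; linarith) ?_
    have := norm_sub_norm_le y x
    simp only at h1 h2
    linarith
  have hmem : ∀ z ∈ Z, ∀ w ∈ M, z ≠ 0 → ‖w - z‖ ≤ ‖z‖ →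
      ((‖z‖⁻¹ : ℂ) • z, (‖z‖⁻¹ : ℂ) • w) ∈ S := by
    intro z hz w hw hz0 hwz
    have hn : ‖z‖ ≠ 0 := norm_ne_zero_iff.2 hz0
    refine ⟨hZc _ _ hz, Or.inr (hMc _ (by simpa using hz0) _ hw), ?_, ?_⟩
    · simp [norm_smul, hn]
    · change ‖(‖z‖⁻¹ : ℂ) • w - (‖z‖⁻¹ : ℂ) • z‖ ≤ 1
      rw [← smul_sub, norm_smul, norm_inv, Complex.norm_real, norm_norm,
        inv_mul_le_iff₀ (norm_pos_iff.2 hz0), mul_one]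
      exact hwz
  set u : ℂ := inner ℂ w₁ z₁ / ‖w₁‖ ^ 2 with hu
  have hu0 : u ≠ 0 := div_ne_zero hwz (by simpa using hw0)
  have hlt : ‖u • w₁ - z₁‖ < ‖z₁‖ := by
    have horth : inner ℂ (u • w₁) (z₁ - u • w₁) = 0 := by
      rw [inner_smul_left, inner_sub_right, inner_smul_right, inner_self_eq_norm_sq_to_K, hu]
      have : (‖w₁‖ : ℂ) ≠ 0 := by simpa using hw0
      simp only [Complex.coe_algebraMap]
      field_simp
      simp
    have hpyth := norm_add_sq_eq_norm_sq_add_norm_sq_of_inner_eq_zero _ _ horth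
    rw [add_sub_cancel] at hpyth
    have hpos : 0 < ‖u • w₁‖ := norm_pos_iff.2 (smul_ne_zero hu0 hw0)
    rw [norm_sub_rev]
    nlinarith [norm_nonneg (z₁ - u • w₁), norm_nonneg z₁]
  have hx₁ := hmem z₁ hz₁ (u • w₁) (hMc u hu0 _ hw₁) hz0 hlt.le
  obtain ⟨⟨z₀, w₀⟩, hx₀, hmin⟩ := (Metric.isCompact_of_isClosed_isBounded hScl hSb).exists_isMinOn
    ⟨_, hx₁⟩ (f := fun x => ‖x.2 - x.1‖) (by fun_prop)
  have hscale : ∀ z ∈ Z, ∀ w ∈ M, z ≠ 0 → ‖w - z‖ ≤ ‖z‖ → ‖w₀ - z₀‖ * ‖z‖ ≤ ‖w - z‖ := by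
    intro z hz w hw hz0 hwz
    have h : ‖w₀ - z₀‖ ≤ ‖(‖z‖⁻¹ : ℂ) • w - (‖z‖⁻¹ : ℂ) • z‖ := hmin (hmem z hz w hw hz0 hwz)
    rwa [← smul_sub, norm_smul, norm_inv, Complex.norm_real, norm_norm,
      le_inv_mul_iff₀ (norm_pos_iff.2 hz0), mul_comm] at h
  have hc1 : ‖w₀ - z₀‖ < 1 := by
    have h1 := hscale z₁ hz₁ (u • w₁) (hMc u hu0 _ hw₁) hz0 hlt.le
    have h2 := norm_pos_iff.2 hz0
    by_contra! hcon
    nlinarith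
  obtain ⟨hz₀, hw₀, hn, hle⟩ := hx₀
  simp only at hz₀ hw₀ hn hle
  refine ⟨z₀, hz₀, hn, w₀, ?_, fun z hz w hw => ?_⟩
  · refine hw₀.resolve_left ?_
    rintro rfl
    rw [zero_sub, norm_neg, hn] at hc1
    exact lt_irrefl _ hc1
  · by_cases hz0 : z = 0
    · simp [hz0]
    · rcases le_total ‖w - z‖ ‖z‖ with h | h
      · exact hscale z hz w hw hz0 h
      · exact (mul_le_of_le_one_left (norm_nonneg z) hc1.le).trans h

open Filter Topology in
/-- A closed cone that is locally a union of level sets of holomorphic functions meets every cone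
that admits a finite projection onto a space of dimension at least two. -/
theorem IsFiniteProjection.not_disjoint_of_levelSets {σ : Type*} [Fintype σ] {k : ℕ}
    {Z : Set (σ → ℂ)} {Y : Fin k → MvPolynomial σ ℂ} {D : ℕ} (h : IsFiniteProjection Z Y D)
    (hk : 2 ≤ k) (hZ : IsClosed Z) (hZc : ∀ t : ℂ, ∀ z ∈ Z, t • z ∈ Z) (hZ0 : ∃ z ∈ Z, z ≠ 0)
    {M : Set (σ → ℂ)} (hMne : M.Nonempty) (hM0 : 0 ∉ M) (hM : IsClosed (insert 0 M))
    (hMc : ∀ t : ℂ, t ≠ 0 → ∀ w ∈ M, t • w ∈ M)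
    (hlevel : ∀ m ∈ M, ∃ f : (σ → ℂ) → ℂ, AnalyticAt ℂ f m ∧ ∀ᶠ w in 𝓝 m, f w = f m → w ∈ M) :
    ¬ Disjoint M Z := by
  intro hdisj
  have hMZ : ∀ w ∈ M, w ∉ Z := fun w hw hwZ => Set.disjoint_left.1 hdisj hw hwZ
  obtain ⟨w₁, hw₁⟩ := hMne
  obtain ⟨z₁, hz₁, hz₁0⟩ := hZ0
  obtain ⟨T, hT⟩ := exists_equiv_inner_ne_zero (ne_of_mem_of_not_mem hw₁ hM0) hz₁0
  have hpre : T.symm ⁻¹' insert 0 M = insert 0 (T.symm ⁻¹' M) := Set.ext fun x => by simp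
  obtain ⟨zz, hzz, hzn, ww, hww, hmin'⟩ := exists_closest_directions
    (Z := T.symm ⁻¹' Z) (M := T.symm ⁻¹' M) (hZ.preimage T.symm.continuous)
    (fun t z hz => by simpa using hZc t _ hz)
    (hpre ▸ hM.preimage T.symm.continuous)
    (fun t ht z hz => by simpa using hMc t ht _ hz)
    ⟨T w₁, by simpa using hw₁, T z₁, by simpa using hz₁, hT⟩
  obtain ⟨z₀, rfl⟩ := T.surjective zz
  obtain ⟨w₀, rfl⟩ := T.surjective ww
  simp only [Set.mem_preimage, ContinuousLinearEquiv.symm_apply_apply] at hzz hww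
  have hmin : ∀ z ∈ Z, ∀ w ∈ M, ‖T (w₀ - z₀)‖ * ‖T z‖ ≤ ‖T (w - z)‖ := by
    intro z hz w hw
    rw [map_sub, map_sub]
    exact hmin' _ (by simpa using hz) _ (by simpa using hw)
  have hc0 : 0 < ‖T (w₀ - z₀)‖ := by
    rw [norm_pos_iff, ne_eq, T.map_eq_zero_iff, sub_eq_zero]
    rintro rfl
    exact hMZ _ hww hzz
  have hz₀0 : z₀ ≠ 0 := by rintro rfl; simp at hzn
  obtain ⟨A, hAe⟩ : ∃ A : ℂ → (σ → ℂ) →ₗ[ℂ] (σ → ℂ),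
      ∀ t z, A t z = z + (t * inner ℂ (T z₀) (T z)) • (w₀ - z₀) :=
    ⟨fun t => LinearMap.id + (t • ((innerₛₗ ℂ (T z₀)).comp T.toLinearMap)).smulRight (w₀ - z₀),
      fun t z => by simp⟩
  have hAcont : Continuous fun x : ℂ × (σ → ℂ) => A x.1 x.2 := by
    simp only [hAe]
    have : Continuous fun x : ℂ × (σ → ℂ) => T x.2 := T.continuous.comp continuous_snd
    fun_prop
  have hA1 : A 1 z₀ = w₀ := by
    rw [hAe, inner_self_eq_norm_sq_to_K, hzn]
    simp
  have hAM : ∀ t : ℂ, ∀ z ∈ Z, A t z ∈ M → ‖T z‖ ≤ ‖t‖ * ‖inner ℂ (T z₀) (T z)‖ := by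
    intro t z hz hm
    have := hmin z hz _ hm
    rw [hAe, add_sub_cancel_left, map_smul, norm_smul, norm_mul,
      mul_comm ‖T (w₀ - z₀)‖] at this
    exact le_of_mul_le_mul_right this hc0
  obtain ⟨f, hf, hfM⟩ := hlevel w₀ hww
  obtain ⟨R₁, hR₁, happrox⟩ := hf.exists_mvPolynomial_approx
  obtain ⟨R₂, hR₂, hball⟩ := Metric.eventually_nhds_iff_ball.1 (hfM.and hf.eventually_analyticAt)
  set R := min R₁ R₂ with hR
  have hRpos : 0 < R := lt_min hR₁ hR₂
  have hR1 : Metric.ball w₀ R ⊆ Metric.ball w₀ R₁ := Metric.ball_subset_ball (min_le_left _ _)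
  have hR2 : Metric.ball w₀ R ⊆ Metric.ball w₀ R₂ := Metric.ball_subset_ball (min_le_right _ _)
  have hA1cont : Continuous (A 1) := (A 1).continuous_of_finiteDimensional
  have hev₀ : {z | z ≠ 0 ∧ A 1 z ∈ Metric.ball w₀ R} ∈ 𝓝 z₀ :=
    (isOpen_ne.inter (Metric.isOpen_ball.preimage hA1cont)).mem_nhds
      ⟨hz₀0, by rw [Set.mem_preimage, hA1]; exact Metric.mem_ball_self hRpos⟩
  obtain ⟨ρ, hρ, hρB⟩ := Metric.nhds_basis_closedBall.mem_iff.1 hev₀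
  have hgcont : ContinuousOn (fun z => f (A 1 z) - f w₀) (Metric.closedBall z₀ ρ) := by
    intro z hz
    have h1 : ContinuousAt f (A 1 z) := (hball _ (hR2 (hρB hz).2)).2.continuousAt
    exact ((ContinuousAt.comp (f := A 1) h1 hA1cont.continuousAt).sub
      continuousAt_const).continuousWithinAt
  obtain ⟨ε, hε, hzero⟩ := h.exists_zero_of_approx hk hZ hz₀0 (fun t => hZc t _ hzz) hρ hgcont
    (by simp [hA1]) (by
      intro z hz hzB hg
      have hzM : A 1 z ∈ M := (hball _ (hR2 (hρB hzB).2)).1 (sub_eq_zero.1 hg)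
      have h1 := hAM 1 z hz hzM
      rw [norm_one, one_mul] at h1
      have h2 := norm_inner_le_norm (𝕜 := ℂ) (T z₀) (T z)
      rw [hzn, one_mul] at h2
      have hz0 : T z ≠ 0 := by simpa using (hρB hzB).1
      obtain ⟨t, -, ht⟩ := (norm_inner_eq_norm_iff (𝕜 := ℂ) (x := T z₀) (y := T z)
        (by simpa using hz₀0) hz0).1 (by rw [hzn, one_mul]; exact le_antisymm h2 h1)
      exact ⟨t, T.injective (by rw [ht, map_smul])⟩)
  have hev : ∀ᶠ t : ℂ in 𝓝 1, ∀ z ∈ Metric.closedBall z₀ ρ,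
      A t z ∈ Metric.ball w₀ R ∧ ‖f (A t z) - f (A 1 z)‖ < ε / 2 := by
    refine (isCompact_closedBall z₀ ρ).eventually_forall_of_forall_eventually fun z hz => ?_
    have hmem : A 1 z ∈ Metric.ball w₀ R := (hρB hz).2
    have hc1 : ContinuousAt (fun x : ℂ × (σ → ℂ) => A x.1 x.2) (1, z) := hAcont.continuousAt
    have hfc : ContinuousAt f (A 1 z) := (hball _ (hR2 hmem)).2.continuousAt
    have hc2 : ContinuousAt (fun x : ℂ × (σ → ℂ) => ‖f (A x.1 x.2) - f (A 1 x.2)‖) (1, z) := by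
      refine (ContinuousAt.sub ?_ ?_).norm
      · exact ContinuousAt.comp (f := fun x : ℂ × (σ → ℂ) => A x.1 x.2) hfc hc1
      · exact ContinuousAt.comp (f := fun x : ℂ × (σ → ℂ) => A 1 x.2) hfc
          (hA1cont.comp continuous_snd).continuousAt
    refine (hc1.eventually_mem (Metric.isOpen_ball.mem_nhds hmem)).and
      (hc2.eventually_lt continuousAt_const ?_)
    simpa using half_pos hε
  obtain ⟨t, ht1, htB⟩ : ∃ t : ℂ, ‖t‖ < 1 ∧ ∀ z ∈ Metric.closedBall z₀ ρ,
      A t z ∈ Metric.ball w₀ R ∧ ‖f (A t z) - f (A 1 z)‖ < ε / 2 := by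
    have h1 : (1 : ℂ) ∈ closure (Metric.ball (0 : ℂ) 1) := by
      rw [closure_ball _ one_ne_zero]; simp
    obtain ⟨t, ht⟩ := mem_closure_iff_nhds.1 h1 _ hev
    exact ⟨t, by simpa using ht.2, ht.1⟩
  have hne : ∀ z ∈ Z ∩ Metric.closedBall z₀ ρ, f (A t z) ≠ f w₀ := by
    rintro z ⟨hz, hzB⟩ hfz
    have h1 := hAM t z hz ((hball _ (hR2 (htB z hzB).1)).1 hfz)
    have h2 := norm_inner_le_norm (𝕜 := ℂ) (T z₀) (T z)
    rw [hzn, one_mul] at h2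
    have h3 : 0 < ‖T z‖ := by
      rw [norm_pos_iff]; simpa using (hρB hzB).1
    nlinarith [norm_nonneg t]
  have hAtcont : Continuous (A t) := (A t).continuous_of_finiteDimensional
  obtain ⟨δ, hδ, hδf⟩ := ((isCompact_closedBall z₀ ρ).inter_left hZ).exists_pos_forall_le
    (f := fun z => ‖f (A t z) - f w₀‖) (by
      intro z hz
      have h1 : ContinuousAt f (A t z) := (hball _ (hR2 (htB z hz.2).1)).2.continuousAt
      exact ((ContinuousAt.comp (f := A t) h1 hAtcont.continuousAt).sub
        continuousAt_const).norm.continuousWithinAt)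
    (fun z hz => norm_pos_iff.2 (sub_ne_zero.2 (hne z hz)))
  obtain ⟨p, hp⟩ := happrox (min (ε / 2) (δ / 2)) (by positivity)
  obtain ⟨q, hq⟩ := p.exists_eval_linearMap (A t)
  have hqe : ∀ z ∈ Metric.closedBall z₀ ρ, ‖eval z (q - C (f w₀)) - (f (A t z) - f w₀)‖ ≤
      min (ε / 2) (δ / 2) := by
    intro z hz
    rw [map_sub, eval_C, hq, sub_sub_sub_cancel_right]
    exact hp _ (hR1 (htB z hz).1)
  obtain ⟨z, hz, hzB, hz0⟩ := hzero (q - C (f w₀)) fun z hz => by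
    have h1 := (hqe z hz).trans (min_le_left _ _)
    have h2 := (htB z hz).2
    calc _ = ‖(eval z (q - C (f w₀)) - (f (A t z) - f w₀)) + (f (A t z) - f (A 1 z))‖ := by
          congr 1; ring
      _ ≤ ε / 2 + ε / 2 := (norm_add_le _ _).trans (add_le_add h1 h2.le)
      _ = ε := add_halves ε
  have h1 := (hqe z hzB).trans (min_le_right _ _)
  have h2 : δ ≤ ‖f (A t z) - f w₀‖ := hδf z ⟨hz, hzB⟩
  rw [hz0, zero_sub, norm_neg] at h1
  linarith

/-- The primitive vanishing at `0` of the constant extension of `w` to the real line. -/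
noncomputable def unitIntervalPrimitive (w : C(unitInterval, ℂ)) (t : ℝ) : ℂ :=
  ∫ s in (0 : ℝ)..t, Set.IccExtend zero_le_one w s

theorem continuous_iccExtend_unitInterval (w : C(unitInterval, ℂ)) :
    Continuous (Set.IccExtend (zero_le_one : (0 : ℝ) ≤ 1) w) :=
  w.continuous.Icc_extend'

theorem hasDerivAt_unitIntervalPrimitive (w : C(unitInterval, ℂ)) (t : ℝ) :
    HasDerivAt (unitIntervalPrimitive w) (Set.IccExtend zero_le_one w t) t :=
  intervalIntegral.integral_hasDerivAt_right
    ((continuous_iccExtend_unitInterval w).intervalIntegrable _ _)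
    ((continuous_iccExtend_unitInterval w).stronglyMeasurableAtFilter _ _)
    (continuous_iccExtend_unitInterval w).continuousAt

/-- Integration from `0`, as a bounded operator on continuous functions on the unit interval. -/
noncomputable def unitIntervalVolterra : C(unitInterval, ℂ) →L[ℂ] C(unitInterval, ℂ) :=
  LinearMap.mkContinuous
    { toFun := fun w => ⟨fun t => unitIntervalPrimitive w t,
        (continuous_iff_continuousAt.2 fun t =>
          (hasDerivAt_unitIntervalPrimitive w t).continuousAt).comp continuous_subtype_val⟩
      map_add' := fun w w' => by
        ext t
        exact intervalIntegral.integral_add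
          ((continuous_iccExtend_unitInterval w).intervalIntegrable _ _)
          ((continuous_iccExtend_unitInterval w').intervalIntegrable _ _)
      map_smul' := fun c w => by
        ext t
        exact intervalIntegral.integral_smul c (Set.IccExtend zero_le_one w) } 1 (by
    intro w
    rw [one_mul]
    refine (ContinuousMap.norm_le _ (norm_nonneg w)).2 fun t => ?_
    refine (intervalIntegral.norm_integral_le_of_norm_le_const (C := ‖w‖)
      fun s _ => w.norm_coe_le_norm _).trans ?_
    rw [sub_zero, abs_of_nonneg t.2.1]
    exact mul_le_of_le_one_right (norm_nonneg w) t.2.2)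

theorem MvPolynomial.hasDerivAt_eval {𝕜 σ : Type*} [NontriviallyNormedField 𝕜]
    [NormedAlgebra 𝕜 ℂ] [Fintype σ] (p : MvPolynomial σ ℂ) {c : 𝕜 → σ → ℂ} {c' : σ → ℂ} {s : 𝕜}
    (hc : ∀ i, HasDerivAt (fun s => c s i) (c' i) s) :
    HasDerivAt (fun s => eval (c s) p) (∑ j, eval (c s) (pderiv j p) * c' j) s := by
  classical
  induction p using MvPolynomial.induction_on with
  | C a => simpa using hasDerivAt_const s a
  | add p q hp hq =>
    simp only [map_add, add_mul, Finset.sum_add_distrib]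
    exact HasDerivAt.fun_add hp hq
  | mul_X p i hp =>
    simp only [map_mul, eval_X, Derivation.leibniz, smul_eq_mul, map_add, pderiv_X]
    refine (HasDerivAt.fun_mul hp (hc i)).congr_deriv ?_
    simp only [add_mul, Finset.sum_add_distrib, Finset.sum_mul]
    rw [add_comm]
    congr 1
    · rw [Finset.sum_eq_single i]
      · simp
      · intro j _ hj
        simp [Pi.single_eq_of_ne hj.symm]
      · simp
    · exact Finset.sum_congr rfl fun j _ => by ring

theorem sum_integrability_contract {σ : Type*} [Fintype σ] (α : σ → ℂ) (B : σ → σ → ℂ)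
    (h : ∀ i j k, α i * (B j k - B k j) + α j * (B k i - B i k) + α k * (B i j - B j i) = 0)
    (u v w : σ → ℂ) :
    (∑ i, α i * u i) * ((∑ i, (∑ j, B j i * v j) * w i) - ∑ i, (∑ j, B j i * w j) * v i) +
    (∑ i, α i * v i) * ((∑ i, (∑ j, B j i * w j) * u i) - ∑ i, (∑ j, B j i * u j) * w i) +
    (∑ i, α i * w i) * ((∑ i, (∑ j, B j i * u j) * v i) - ∑ i, (∑ j, B j i * v j) * u i) = 0 := by
  have key : ∀ x y z : σ → ℂ, (∑ i, α i * x i) * (∑ i, (∑ j, B j i * y j) * z i) =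
      ∑ i, ∑ j, ∑ k, α i * x i * (B j k * y j * z k) := by
    intro x y z
    rw [Finset.sum_mul_sum]
    simp only [Finset.sum_mul, Finset.mul_sum]
    exact Finset.sum_congr rfl fun i _ => Finset.sum_comm
  have swap : ∀ g : σ → σ → σ → ℂ, ∑ i, ∑ j, ∑ k, g i j k = ∑ i, ∑ j, ∑ k, g i k j := fun g =>
    Finset.sum_congr rfl fun i _ => Finset.sum_comm
  have swap' : ∀ g : σ → σ → σ → ℂ, ∑ i, ∑ j, ∑ k, g i j k = ∑ i, ∑ j, ∑ k, g j i k := fun g =>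
    Finset.sum_comm
  have rot : ∀ g : σ → σ → σ → ℂ, ∑ i, ∑ j, ∑ k, g i j k = ∑ i, ∑ j, ∑ k, g j k i := fun g => by
    rw [swap' fun i j k => g j k i, swap fun i j k => g i k j]
  simp only [mul_sub, key]
  rw [swap fun i j k => α i * u i * (B j k * w j * v k),
    rot fun i j k => α i * v i * (B j k * w j * u k),
    swap' fun i j k => α i * v i * (B j k * u j * w k),
    rot fun i j k => α i * w i * (B j k * u j * v k),
    rot fun i j k => α j * w j * (B k i * u k * v i),
    rot fun i j k => α i * w i * (B j k * v j * u k),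
    swap fun i j k => α j * w j * (B k i * v k * u i)]
  simp only [← Finset.sum_sub_distrib, ← Finset.sum_add_distrib]
  refine Finset.sum_eq_zero fun i _ => Finset.sum_eq_zero fun j _ => Finset.sum_eq_zero fun k _ => ?_
  linear_combination u i * v j * w k * h i j k

theorem sum_mul_eq_zero_of_variation {σ : Type*} [Fintype σ] {a : σ → MvPolynomial σ ℂ}
    (ha : ∀ i j k, a i * (pderiv j (a k) - pderiv k (a j)) +
      a j * (pderiv k (a i) - pderiv i (a k)) + a k * (pderiv i (a j) - pderiv j (a i)) = 0)
    (e : σ → ℂ) {γ γ' ξ ξ' : ℝ → σ → ℂ} (hγ : ∀ t i, HasDerivAt (fun t => γ t i) (γ' t i) t)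
    (hξ : ∀ t i, HasDerivAt (fun t => ξ t i) (ξ' t i) t) (hγc : Continuous γ')
    (htan : ∀ t ∈ Set.Icc (0 : ℝ) 1, ∑ i, eval (γ t) (a i) * γ' t i = 0)
    (hvar : ∀ t ∈ Set.Icc (0 : ℝ) 1,
      ∑ i, (∑ j, eval (γ t) (pderiv j (a i)) * ξ t j) * γ' t i +
        ∑ i, eval (γ t) (a i) * ξ' t i = 0)
    (he : ∀ t ∈ Set.Icc (0 : ℝ) 1, ∑ i, eval (γ t) (a i) * e i ≠ 0)
    (h0 : ∑ i, eval (γ 0) (a i) * ξ 0 i = 0) :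
    ∑ i, eval (γ 1) (a i) * ξ 1 i = 0 := by
  have hγcont : Continuous γ := continuous_pi fun i =>
    continuous_iff_continuousAt.2 fun t => (hγ t i).continuousAt
  have hev : ∀ p : MvPolynomial σ ℂ, Continuous fun t => eval (γ t) p := fun p =>
    (MvPolynomial.continuous_eval p).comp hγcont
  have hγ'c : ∀ i, Continuous fun t => γ' t i := fun i => (continuous_apply i).comp hγc
  have hE : ∀ t, HasDerivAt (fun t => ∑ i, eval (γ t) (a i) * ξ t i)
      (∑ i, ((∑ j, eval (γ t) (pderiv j (a i)) * γ' t j) * ξ t i +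
        eval (γ t) (a i) * ξ' t i)) t := fun t =>
    HasDerivAt.fun_sum fun i _ =>
      (MvPolynomial.hasDerivAt_eval (a i) (hγ t)).fun_mul (hξ t i)
  let κ : ℝ → ℂ := fun t => (∑ i, (∑ j, eval (γ t) (pderiv j (a i)) * e j) * γ' t i -
    ∑ i, (∑ j, eval (γ t) (pderiv j (a i)) * γ' t j) * e i) / ∑ i, eval (γ t) (a i) * e i
  have hκ : ContinuousOn κ (Set.Icc 0 1) := by
    refine ContinuousOn.div (Continuous.continuousOn ?_) (Continuous.continuousOn ?_) he
    · have := hev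
      fun_prop
    · have := hev
      fun_prop
  obtain ⟨K, hK⟩ := isCompact_Icc.exists_bound_of_continuousOn hκ
  refine eq_zero_of_abs_deriv_le_mul_abs_self_of_eq_zero_right (a := 0) (b := 1) (K := K)
    (f := fun t => ∑ i, eval (γ t) (a i) * ξ t i)
    (continuous_iff_continuousAt.2 fun t => (hE t).continuousAt).continuousOn
    (fun t _ => (hE t).hasDerivWithinAt) h0 (fun t ht => ?_) 1 (Set.right_mem_Icc.2 zero_le_one)
  have ht' := Set.Ico_subset_Icc_self ht
  have hd : ∑ i, ((∑ j, eval (γ t) (pderiv j (a i)) * γ' t j) * ξ t i +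
      eval (γ t) (a i) * ξ' t i) = - κ t * ∑ i, eval (γ t) (a i) * ξ t i := by
    have hc := sum_integrability_contract (fun i => eval (γ t) (a i))
      (fun j i => eval (γ t) (pderiv j (a i)))
      (fun i j k => by simpa using congrArg (eval (γ t)) (ha i j k)) e (γ' t) (ξ t)
    have hv := hvar t ht'
    rw [htan t ht', zero_mul, add_zero] at hc
    have hne := he t ht'
    simp only [κ, Finset.sum_add_distrib]
    field_simp
    linear_combination hc + hv * ∑ i, eval (γ t) (a i) * e i
  rw [hd, norm_mul, norm_neg]
  exact mul_le_mul_of_nonneg_right (hK t ht') (norm_nonneg _)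

/-- The path `t ↦ z + t (m - z) + (∫₀ᵗ w) e`, coordinatewise an element of the Banach algebra of
continuous functions on the unit interval. -/
noncomputable def connectingPath {σ : Type*} (m e z : σ → ℂ) (w : C(unitInterval, ℂ)) (i : σ) :
    C(unitInterval, ℂ) :=
  algebraMap ℂ _ (z i) + ⟨fun t => ((t : ℝ) : ℂ), by fun_prop⟩ * algebraMap ℂ _ (m i - z i) +
    unitIntervalVolterra w * algebraMap ℂ _ (e i)

theorem connectingPath_apply {σ : Type*} (m e z : σ → ℂ) (w : C(unitInterval, ℂ)) (i : σ)
    (t : unitInterval) : connectingPath m e z w i t =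
      z i + (t : ℝ) * (m i - z i) + unitIntervalPrimitive w t * e i := rfl

theorem connectingPath_self {σ : Type*} (m e : σ → ℂ) (i : σ) :
    connectingPath m e m 0 i = algebraMap ℂ _ (m i) := by
  simp [connectingPath]

theorem MvPolynomial.aeval_continuousMap_apply {σ : Type*} (g : σ → C(unitInterval, ℂ))
    (p : MvPolynomial σ ℂ) (t : unitInterval) :
    (aeval g p : C(unitInterval, ℂ)) t = eval (fun i => g i t) p := by
  have h := MvPolynomial.comp_aeval_apply (R := ℂ) (f := g) (ContinuousMap.evalAlgHom ℂ ℂ t) p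
  rw [MvPolynomial.aeval_eq_eval] at h
  exact h

/-- The form `∑ aᵢ dzᵢ` evaluated on the velocity of `connectingPath`. -/
noncomputable def pathForm {σ : Type*} [Fintype σ] (a : σ → MvPolynomial σ ℂ) (m e : σ → ℂ)
    (x : (σ → ℂ) × C(unitInterval, ℂ)) : C(unitInterval, ℂ) :=
  ∑ i, aeval (connectingPath m e x.1 x.2) (a i) *
    (algebraMap ℂ _ (m i - x.1 i) + x.2 * algebraMap ℂ _ (e i))

theorem pathForm_apply {σ : Type*} [Fintype σ] (a : σ → MvPolynomial σ ℂ) (m e : σ → ℂ)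
    (x : (σ → ℂ) × C(unitInterval, ℂ)) (t : unitInterval) : pathForm a m e x t =
      ∑ i, eval (fun i => connectingPath m e x.1 x.2 i t) (a i) * (m i - x.1 i + x.2 t * e i) := by
  rw [pathForm, ContinuousMap.sum_apply]
  refine Finset.sum_congr rfl fun i _ => ?_
  rw [ContinuousMap.mul_apply, MvPolynomial.aeval_continuousMap_apply]
  rfl

theorem analyticAt_connectingPath {σ : Type*} [Fintype σ] (m e : σ → ℂ) (i : σ)
    (x : (σ → ℂ) × C(unitInterval, ℂ)) :
    AnalyticAt ℂ (fun x : (σ → ℂ) × C(unitInterval, ℂ) => connectingPath m e x.1 x.2 i) x := by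
  have h1 : AnalyticAt ℂ (fun x : (σ → ℂ) × C(unitInterval, ℂ) =>
      algebraMap ℂ C(unitInterval, ℂ) (x.1 i)) x :=
    ((algebraMapCLM ℂ C(unitInterval, ℂ)).comp ((ContinuousLinearMap.proj i).comp
      (ContinuousLinearMap.fst ℂ (σ → ℂ) C(unitInterval, ℂ)))).analyticAt x
  have h2 : AnalyticAt ℂ (fun x : (σ → ℂ) × C(unitInterval, ℂ) =>
      unitIntervalVolterra x.2) x :=
    (unitIntervalVolterra.comp
      (ContinuousLinearMap.snd ℂ (σ → ℂ) C(unitInterval, ℂ))).analyticAt x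
  simp only [connectingPath, map_sub]
  fun_prop

theorem analyticAt_pathForm {σ : Type*} [Fintype σ] (a : σ → MvPolynomial σ ℂ) (m e : σ → ℂ)
    (x : (σ → ℂ) × C(unitInterval, ℂ)) : AnalyticAt ℂ (pathForm a m e) x := by
  have h1 : ∀ i, AnalyticAt ℂ (fun x : (σ → ℂ) × C(unitInterval, ℂ) =>
      algebraMap ℂ C(unitInterval, ℂ) (x.1 i)) x := fun i =>
    ((algebraMapCLM ℂ C(unitInterval, ℂ)).comp ((ContinuousLinearMap.proj i).comp
      (ContinuousLinearMap.fst ℂ (σ → ℂ) C(unitInterval, ℂ)))).analyticAt x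
  unfold pathForm
  refine Finset.analyticAt_fun_sum _ fun i _ =>
    (AnalyticAt.aeval_mvPolynomial (fun j => analyticAt_connectingPath m e j x) (a i)).mul ?_
  simp only [map_sub]
  exact (analyticAt_const.sub (h1 i)).add (analyticAt_snd.mul analyticAt_const)

theorem exists_pathForm_implicitFunction {σ : Type*} [Fintype σ] (a : σ → MvPolynomial σ ℂ)
    (m e : σ → ℂ) (he : ∑ i, eval m (a i) * e i ≠ 0) :
    ∃ W : (σ → ℂ) → C(unitInterval, ℂ), AnalyticAt ℂ W m ∧ W m = 0 ∧
      ∀ᶠ z in nhds m, pathForm a m e (z, W z) = 0 := by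
  have hΦ : ContDiffAt ℂ ⊤ (pathForm a m e) (m, 0) := (analyticAt_pathForm a m e (m, 0)).contDiffAt
  have hself : pathForm a m e (m, 0) = 0 := by simp [pathForm]
  have hinv : (fderiv ℂ (pathForm a m e) (m, 0) ∘L
      .inr ℂ (σ → ℂ) C(unitInterval, ℂ)).IsInvertible := by
    have h1 : HasFDerivAt (fun w => pathForm a m e (m, w)) (fderiv ℂ (pathForm a m e) (m, 0) ∘L
        .inr ℂ (σ → ℂ) C(unitInterval, ℂ)) 0 :=
      (analyticAt_pathForm a m e (m, 0)).differentiableAt.hasFDerivAt.comp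
        (0 : C(unitInterval, ℂ)) (hasFDerivAt_prodMk_right m 0)
    let P : C(unitInterval, ℂ) → C(unitInterval, ℂ) := fun w =>
      ∑ i, aeval (connectingPath m e m w) (a i) * algebraMap ℂ _ (e i)
    have hP : DifferentiableAt ℂ P 0 := by
      refine DifferentiableAt.fun_sum fun i _ => DifferentiableAt.mul ?_ (by fun_prop)
      exact (AnalyticAt.aeval_mvPolynomial (fun j => analyticAt_connectingPath m e j (m, 0))
        (a i)).differentiableAt.comp (0 : C(unitInterval, ℂ))
          (hasFDerivAt_prodMk_right (𝕜 := ℂ) m (0 : C(unitInterval, ℂ))).differentiableAt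
    have hP0 : P 0 = algebraMap ℂ _ (∑ i, eval m (a i) * e i) := by
      simp only [P, map_sum, map_mul]
      refine Finset.sum_congr rfl fun i _ => ?_
      congr 1
      rw [funext (connectingPath_self m e)]
      exact (MvPolynomial.aeval_algebraMap_apply _ m (a i)).trans
        (by rw [MvPolynomial.aeval_eq_eval])
    have h2 : (fun w => pathForm a m e (m, w)) = fun w => P w * w := by
      funext w
      simp only [pathForm, P, sub_self, map_zero, zero_add, Finset.sum_mul]
      exact Finset.sum_congr rfl fun i _ => by ring
    rw [h2] at h1
    have h3 := h1.unique (hP.hasFDerivAt.mul (hasFDerivAt_id 0))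
    refine ⟨ContinuousLinearEquiv.smulLeft (Units.mk0 _ he), ?_⟩
    rw [h3, hP0]
    ext w t
    simp [Algebra.algebraMap_eq_smul_one, Units.smul_def]
  refine ⟨hΦ.implicitFunction (by simp) hinv, (hΦ.contDiffAt_implicitFunction _ hinv).analyticAt,
    hΦ.implicitFunction_apply_self _ hinv, ?_⟩
  have := hΦ.eventually_apply_implicitFunction (by simp) hinv
  rwa [hself] at this

theorem pathForm_variation {σ : Type*} [Fintype σ] {a : σ → MvPolynomial σ ℂ} {m e z : σ → ℂ}
    {W : (σ → ℂ) → C(unitInterval, ℂ)} (hW : DifferentiableAt ℂ W z)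
    (hz : ∀ᶠ z in nhds z, pathForm a m e (z, W z) = 0) (v : σ → ℂ) (t : unitInterval) :
    ∑ i, (∑ j, eval (fun i => connectingPath m e z (W z) i t) (pderiv j (a i)) *
        (v j - (t : ℝ) * v j + unitIntervalPrimitive (fderiv ℂ W z v) t * e j)) *
          (m i - z i + W z t * e i) +
      ∑ i, eval (fun i => connectingPath m e z (W z) i t) (a i) *
        (-v i + fderiv ℂ W z v t * e i) = 0 := by
  have hline : HasDerivAt (fun s : ℂ => z + s • v) v 0 := by
    simpa using ((hasDerivAt_id (0 : ℂ)).smul_const v).const_add z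
  have hline0 : z + (0 : ℂ) • v = z := by simp
  have hcoord : ∀ i, HasDerivAt (fun s : ℂ => (z + s • v) i) (v i) 0 := fun i =>
    hasDerivAt_pi.1 hline i
  have hWs : HasDerivAt (fun s : ℂ => W (z + s • v)) (fderiv ℂ W z v) 0 := by
    have h : HasFDerivAt W (fderiv ℂ W z) (z + (0 : ℂ) • v) := by
      rw [hline0]
      exact hW.hasFDerivAt
    exact h.comp_hasDerivAt 0 hline
  have hWt : HasDerivAt (fun s : ℂ => W (z + s • v) t) (fderiv ℂ W z v t) 0 :=
    (ContinuousMap.evalCLM ℂ t : C(unitInterval, ℂ) →L[ℂ] ℂ).hasFDerivAt.comp_hasDerivAt 0 hWs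
  have hYt : HasDerivAt (fun s : ℂ => unitIntervalPrimitive (W (z + s • v)) t)
      (unitIntervalPrimitive (fderiv ℂ W z v) t) 0 :=
    ((ContinuousMap.evalCLM ℂ t).comp unitIntervalVolterra).hasFDerivAt.comp_hasDerivAt 0 hWs
  have hγ : ∀ j, HasDerivAt (fun s : ℂ => connectingPath m e (z + s • v) (W (z + s • v)) j t)
      (v j - (t : ℝ) * v j + unitIntervalPrimitive (fderiv ℂ W z v) t * e j) 0 := fun j => by
    simp only [connectingPath_apply]
    refine (((hcoord j).fun_add (((hcoord j).const_sub (m j)).const_mul ((t : ℝ) : ℂ))).fun_add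
      (hYt.mul_const (e j))).congr_deriv ?_
    ring
  have hD : HasDerivAt (fun s : ℂ => pathForm a m e (z + s • v, W (z + s • v)) t)
      (∑ i, ((∑ j, eval (fun i => connectingPath m e (z + (0 : ℂ) • v) (W (z + (0 : ℂ) • v)) i t)
        (pderiv j (a i)) *
        (v j - (t : ℝ) * v j + unitIntervalPrimitive (fderiv ℂ W z v) t * e j)) *
          (m i - (z + (0 : ℂ) • v) i + W (z + (0 : ℂ) • v) t * e i) +
        eval (fun i => connectingPath m e (z + (0 : ℂ) • v) (W (z + (0 : ℂ) • v)) i t) (a i) *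
          (-v i + fderiv ℂ W z v t * e i))) 0 := by
    simp only [pathForm_apply]
    exact HasDerivAt.fun_sum fun i _ => (MvPolynomial.hasDerivAt_eval (a i) hγ).fun_mul
      (((hcoord i).const_sub (m i)).fun_add (hWt.mul_const (e i)))
  have hzero : (fun s : ℂ => pathForm a m e (z + s • v, W (z + s • v)) t) =ᶠ[nhds 0]
      fun _ => 0 := by
    have hc : Filter.Tendsto (fun s : ℂ => z + s • v) (nhds 0) (nhds z) := by
      have := hline.continuousAt.tendsto
      rwa [hline0] at this
    filter_upwards [hc.eventually hz] with s hs
    rw [hs, ContinuousMap.zero_apply]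
  have h := hD.unique ((hasDerivAt_const (0 : ℂ) (0 : ℂ)).congr_of_eventuallyEq hzero)
  simp only [zero_smul, add_zero, Finset.sum_add_distrib] at h
  exact h

theorem exists_analyticAt_firstIntegral {σ : Type*} [Fintype σ] {a : σ → MvPolynomial σ ℂ}
    (ha : ∀ i j k, a i * (pderiv j (a k) - pderiv k (a j)) +
      a j * (pderiv k (a i) - pderiv i (a k)) + a k * (pderiv i (a j) - pderiv j (a i)) = 0)
    {m : σ → ℂ} (hm : ∃ i, eval m (a i) ≠ 0) :
    ∃ f : (σ → ℂ) → ℂ, AnalyticAt ℂ f m ∧ fderiv ℂ f m ≠ 0 ∧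
      ∀ᶠ z in nhds m, ∀ v, ∑ i, eval z (a i) * v i = 0 → fderiv ℂ f z v = 0 := by
  classical
  obtain ⟨i₀, hi₀⟩ := hm
  obtain ⟨e, he⟩ : ∃ e : σ → ℂ, ∑ i, eval m (a i) * e i ≠ 0 :=
    ⟨Pi.single i₀ 1, by simpa [Pi.single_apply] using hi₀⟩
  obtain ⟨W, hWan, hWm, hWeq⟩ := exists_pathForm_implicitFunction a m e he
  let L : C(unitInterval, ℂ) →L[ℂ] ℂ := (ContinuousMap.evalCLM ℂ 1).comp unitIntervalVolterra
  have hL : ∀ w, L w = unitIntervalPrimitive w 1 := fun _ => rfl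
  have hf : ∀ z v, DifferentiableAt ℂ W z →
      fderiv ℂ (fun z => L (W z)) z v = unitIntervalPrimitive (fderiv ℂ W z v) 1 := by
    intro z v hz
    have h : HasFDerivAt (fun z => L (W z)) (L.comp (fderiv ℂ W z)) z :=
      L.hasFDerivAt.comp z hz.hasFDerivAt
    rw [← hL, h.fderiv]
    rfl
  refine ⟨fun z => L (W z), (L.analyticAt _).fun_comp hWan, fun h0 => ?_, ?_⟩
  · have h1 := hf m e hWan.differentiableAt
    have hone : fderiv ℂ W m e = 1 := by
      ext t
      have h := pathForm_variation hWan.differentiableAt hWeq e t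
      have hpath : (fun i => connectingPath m e m (W m) i t) = m := by
        rw [hWm]
        funext i
        rw [connectingPath_self]
        rfl
      rw [hpath, hWm] at h
      have h' : (∑ i, eval m (a i) * e i) * (fderiv ℂ W m e t - 1) = 0 := by
        rw [Finset.sum_mul]
        simp only [sub_self, ContinuousMap.zero_apply, zero_mul, add_zero, mul_zero,
          Finset.sum_const_zero, zero_add] at h
        rw [← h]
        exact Finset.sum_congr rfl fun i _ => by ring
      simpa [sub_eq_zero, he] using h'
    rw [h0, hone, unitIntervalPrimitive] at h1
    change (0 : ℂ) = ∫ _ in (0 : ℝ)..1, (1 : ℂ) at h1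
    simp at h1
  · have hunit : ∀ᶠ z in nhds m, IsUnit (∑ i, aeval (connectingPath m e z (W z)) (a i) *
        algebraMap ℂ C(unitInterval, ℂ) (e i)) := by
      have hcont : ContinuousAt (fun z => ∑ i, aeval (connectingPath m e z (W z)) (a i) *
          algebraMap ℂ C(unitInterval, ℂ) (e i)) m := by
        refine (Finset.analyticAt_fun_sum _ fun i _ => AnalyticAt.mul
          (AnalyticAt.aeval_mvPolynomial (fun j => ?_) (a i)) analyticAt_const).continuousAt
            (𝕜 := ℂ)
        exact (analyticAt_connectingPath m e j (m, W m)).comp₂ analyticAt_id hWan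
      refine hcont.eventually (Units.isOpen.mem_nhds ?_)
      have : ∑ i, aeval (connectingPath m e m (W m)) (a i) *
          algebraMap ℂ C(unitInterval, ℂ) (e i) =
            algebraMap ℂ _ (∑ i, eval m (a i) * e i) := by
        simp only [map_sum, map_mul]
        refine Finset.sum_congr rfl fun i _ => ?_
        congr 1
        rw [hWm, funext (connectingPath_self m e)]
        exact (MvPolynomial.aeval_algebraMap_apply _ m (a i)).trans
          (by rw [MvPolynomial.aeval_eq_eval])
      beta_reduce
      rw [this]
      exact (IsUnit.mk0 _ he).map _
    filter_upwards [hWan.eventually_analyticAt, hWeq.eventually_nhds, hunit] with z hz hzeq hzu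
    intro v hv
    have hne : ∀ t : unitInterval,
        ∑ i, eval (fun i => connectingPath m e z (W z) i t) (a i) * e i ≠ 0 := by
      intro t
      have := (hzu.map (ContinuousMap.evalAlgHom ℂ ℂ t)).ne_zero
      rw [map_sum] at this
      convert this using 2 with i
      rw [map_mul]
      congr 1
      exact (MvPolynomial.aeval_continuousMap_apply _ (a i) t).symm
    rw [hf z v hz.differentiableAt]
    have hext : ∀ (w : C(unitInterval, ℂ)) (t : ℝ) (ht : t ∈ Set.Icc (0 : ℝ) 1),
        Set.IccExtend (zero_le_one : (0 : ℝ) ≤ 1) w t = w ⟨t, ht⟩ := fun w t ht =>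
      Set.IccExtend_of_mem _ _ ht
    have key := sum_mul_eq_zero_of_variation ha e
      (γ := fun t i => z i + t * (m i - z i) + unitIntervalPrimitive (W z) t * e i)
      (γ' := fun t i => m i - z i + Set.IccExtend (zero_le_one : (0 : ℝ) ≤ 1) (W z) t * e i)
      (ξ := fun t i => v i - t * v i + unitIntervalPrimitive (fderiv ℂ W z v) t * e i)
      (ξ' := fun t i => - v i +
        Set.IccExtend (zero_le_one : (0 : ℝ) ≤ 1) (fderiv ℂ W z v) t * e i)
      (fun t i => by
        refine ((((Complex.ofRealCLM.hasDerivAt (x := t)).mul_const (m i - z i)).const_add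
          (z i)).fun_add ((hasDerivAt_unitIntervalPrimitive (W z) t).mul_const
            (e i))).congr_deriv ?_
        simp)
      (fun t i => by
        refine ((((Complex.ofRealCLM.hasDerivAt (x := t)).mul_const (v i)).const_sub
          (v i)).fun_add ((hasDerivAt_unitIntervalPrimitive (fderiv ℂ W z v) t).mul_const
            (e i))).congr_deriv ?_
        simp)
      (by
        have := continuous_iccExtend_unitInterval (W z)
        fun_prop)
      (fun t ht => by
        have h := congrArg (fun w : C(unitInterval, ℂ) => w ⟨t, ht⟩) hzeq.self_of_nhds
        simp only [pathForm_apply] at h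
        simp only [hext _ t ht]
        exact h)
      (fun t ht => by
        simp only [hext _ t ht]
        exact pathForm_variation hz.differentiableAt hzeq v ⟨t, ht⟩)
      (fun t ht => hne ⟨t, ht⟩)
      (by simpa [unitIntervalPrimitive] using hv)
    have hprod : (∑ i, eval (fun i => connectingPath m e z (W z) i 1) (a i) * e i) *
        unitIntervalPrimitive (fderiv ℂ W z v) 1 = 0 := by
      rw [← key, Finset.sum_mul]
      refine Finset.sum_congr rfl fun i _ => ?_
      simp only [connectingPath_apply, Set.Icc.coe_one, Complex.ofReal_one]
      ring
    exact (mul_eq_zero.1 hprod).resolve_left (hne 1)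

section
open scoped Topology

theorem HasStrictFDerivAt.exists_isPreconnected_levelSets {E : Type*} [NormedAddCommGroup E]
    [NormedSpace ℂ E] [CompleteSpace E] {f : E → ℂ} {f' : E →L[ℂ] ℂ} {m : E}
    (hf : HasStrictFDerivAt f f' m) (hf' : f' ≠ 0) {V : Set E} (hV : V ∈ 𝓝 m) :
    ∃ U ⊆ V, IsOpen U ∧ m ∈ U ∧ ∀ c, IsPreconnected {z ∈ U | f z = c} := by
  have hrange : f'.range = ⊤ := LinearMap.range_eq_top.2
    (LinearMap.surjective fun h => hf' (ContinuousLinearMap.coe_injective h))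
  obtain ⟨φ, hφ, hms, hself⟩ : ∃ φ : OpenPartialHomeomorph E (ℂ × f'.ker),
      (∀ z, (φ z).1 = f z) ∧ m ∈ φ.source ∧ φ m = (f m, 0) :=
    ⟨hf.implicitToOpenPartialHomeomorph f f' hrange,
      fun _ => rfl, hf.mem_implicitToOpenPartialHomeomorph_source hrange,
      hf.implicitToOpenPartialHomeomorph_self hrange⟩
  have hnhds : φ.target ∩ φ.symm ⁻¹' V ∈ 𝓝 (φ m) :=
    Filter.inter_mem (φ.open_target.mem_nhds (φ.map_source hms)) (φ.tendsto_symm hms hV)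
  obtain ⟨ε, hε, hball⟩ := Metric.mem_nhds_iff.1 hnhds
  refine ⟨φ.source ∩ φ ⁻¹' Metric.ball (φ m) ε, fun z hz => ?_,
    φ.isOpen_inter_preimage Metric.isOpen_ball, ⟨hms, Metric.mem_ball_self hε⟩, fun c => ?_⟩
  · have := (hball hz.2).2
    rwa [Set.mem_preimage, φ.left_inv hz.1] at this
  · have hset : {z ∈ φ.source ∩ φ ⁻¹' Metric.ball (φ m) ε | f z = c} =
        φ.symm '' (Metric.ball (φ m) ε ∩ {x | x.1 = c}) := by
      ext z
      constructor
      · rintro ⟨⟨hz, hzb⟩, hzc⟩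
        exact ⟨φ z, ⟨hzb, (hφ z).trans hzc⟩, φ.left_inv hz⟩
      · rintro ⟨x, ⟨hx, hxc⟩, rfl⟩
        have hxt := (hball hx).1
        refine ⟨⟨φ.map_target hxt, ?_⟩, ?_⟩
        · rwa [Set.mem_preimage, φ.right_inv hxt]
        · rw [← hφ, φ.right_inv hxt]
          exact hxc
    rw [hset]
    refine IsPreconnected.image ?_ _ (φ.continuousOn_symm.mono fun x hx => (hball hx.1).1)
    refine ((convex_ball (φ m) ε).inter ?_).isPreconnected
    intro x hx y hy a b _ _ hab
    have hx' : x.1 = c := hx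
    have hy' : y.1 = c := hy
    change a • x.1 + b • y.1 = c
    rw [hx', hy', ← add_smul, hab, one_smul]

/-- Around every regular point there is a first integral whose level sets are plaques. -/
theorem ProjFoliation.exists_plaque_chart {n d : ℕ} (F : ProjFoliation n d)
    {m : Fin (n + 1) → ℂ} (hm0 : m ≠ 0) (hm : m ∉ F.singCone) :
    ∃ (f : (Fin (n + 1) → ℂ) → ℂ) (U : Set (Fin (n + 1) → ℂ)), IsOpen U ∧ m ∈ U ∧
      (∀ z ∈ U, AnalyticAt ℂ f z ∧ fderiv ℂ f z ≠ 0) ∧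
      (∀ z ∈ U, ∀ v, ∑ i, eval z (F.a i) * v i = 0 → fderiv ℂ f z v = 0) ∧
      ∀ z ∈ U, ∀ w ∈ U, f z = f w → F.PlaqueRel z w := by
  obtain ⟨i₀, hi₀⟩ : ∃ i, eval m (F.a i) ≠ 0 := by
    by_contra! h
    exact hm ⟨hm0, h⟩
  obtain ⟨f, hf, hdf, hker⟩ := exists_analyticAt_firstIntegral F.integrable ⟨i₀, hi₀⟩
  have hd : ∀ᶠ z in 𝓝 m, fderiv ℂ f z ≠ 0 :=
    hf.fderiv.continuousAt.eventually_ne hdf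
  have ha : ∀ᶠ z in 𝓝 m, eval z (F.a i₀) ≠ 0 :=
    (MvPolynomial.continuous_eval (F.a i₀)).continuousAt.eventually_ne hi₀
  have hV := hf.eventually_analyticAt.and (hd.and (hker.and (ha.and (eventually_ne_nhds hm0))))
  obtain ⟨U, hUV, hU, hmU, hconn⟩ :=
    hf.hasStrictFDerivAt.exists_isPreconnected_levelSets hdf hV
  refine ⟨f, U, hU, hmU, fun z hz => ⟨(hUV hz).1, (hUV hz).2.1⟩, fun z hz => (hUV hz).2.2.1,
    fun z hz w hw hzw => ⟨U, hU, fun z hz => (hUV hz).2.2.2.2, ?_, f,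
      fun z hz => (hUV hz).1.differentiableAt.differentiableWithinAt,
      fun z hz => (hUV hz).2.1, fun z hz v w => ?_, hz, ?_⟩⟩
  · exact Set.disjoint_left.2 fun z hz hs => (hUV hz).2.2.2.1 (hs.2 i₀)
  · have h := (hUV hz).2.2.1 ((∑ i, eval z (F.a i) * v i) • w - (∑ i, eval z (F.a i) * w i) • v)
      (by
        simp only [Pi.sub_apply, Pi.smul_apply, smul_eq_mul, mul_sub, Finset.sum_sub_distrib,
          mul_left_comm _ (∑ i, eval z (F.a i) * _), ← Finset.mul_sum]
        ring)
    rwa [map_sub, map_smul, map_smul, sub_eq_zero, smul_eq_mul, smul_eq_mul] at h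
  · exact (hconn (f z)).subset_connectedComponentIn ⟨hz, rfl⟩ subset_rfl ⟨hw, hzw.symm⟩

theorem ProjFoliation.smul_notMem_singCone {n d : ℕ} (F : ProjFoliation n d)
    {q : Fin (n + 1) → ℂ} (hq : q ∉ F.singCone) {c : ℂ} (hc : c ≠ 0) : c • q ∉ F.singCone := by
  rintro ⟨h0, h⟩
  refine hq ⟨fun hq0 => h0 (by rw [hq0, smul_zero]), fun i => ?_⟩
  have := h i
  rw [(F.homog i).eval_smul] at this
  exact (mul_eq_zero.1 this).resolve_left (pow_ne_zero _ hc)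

theorem ProjFoliation.eventually_plaqueRel_smul {n d : ℕ} (F : ProjFoliation n d)
    {q : Fin (n + 1) → ℂ} (hq0 : q ≠ 0) (hq : q ∉ F.singCone) :
    ∀ᶠ c : ℂ in 𝓝 1, F.PlaqueRel q (c • q) ∧ F.PlaqueRel (c • q) q := by
  obtain ⟨f, U, hU, hqU, hf, hker, hrel⟩ := F.exists_plaque_chart hq0 hq
  have hcont : Continuous fun c : ℂ => c • q := by fun_prop
  have hmem : ∀ᶠ c : ℂ in 𝓝 1, c • q ∈ U ∧ c ≠ 0 :=
    (hcont.continuousAt.eventually_mem (hU.mem_nhds (by simpa using hqU))).and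
      (eventually_ne_nhds one_ne_zero)
  obtain ⟨ε, hε, hball⟩ := Metric.mem_nhds_iff.1 hmem
  have hderiv : ∀ c ∈ Metric.ball (1 : ℂ) ε, HasDerivAt (fun c : ℂ => f (c • q)) 0 c := by
    intro c hc
    have h1 : HasDerivAt (fun c : ℂ => c • q) q c := by
      simpa using (hasDerivAt_id c).smul_const q
    refine ((hf _ (hball hc).1).1.differentiableAt.hasFDerivAt.comp_hasDerivAt c h1).congr_deriv
      (hker _ (hball hc).1 q ?_)
    have heuler := congrArg (eval (c • q)) F.euler
    simp only [map_sum, map_mul, eval_X, map_zero, Pi.smul_apply, smul_eq_mul, mul_assoc,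
      ← Finset.mul_sum] at heuler
    rw [← (mul_eq_zero.1 heuler).resolve_left (hball hc).2]
    exact Finset.sum_congr rfl fun i _ => mul_comm _ _
  filter_upwards [Metric.ball_mem_nhds 1 hε] with c hc
  have heq : f (c • q) = f q := by
    have := (convex_ball (1 : ℂ) ε).is_const_of_fderivWithin_eq_zero (𝕜 := ℂ)
      (fun c hc => (hderiv c hc).differentiableAt.differentiableWithinAt)
      (fun c hc => by
        rw [fderivWithin_of_isOpen Metric.isOpen_ball hc, (hderiv c hc).hasFDerivAt.fderiv]
        ext
        simp) hc (Metric.mem_ball_self hε)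
    simpa using this
  exact ⟨hrel _ hqU _ (hball hc).1 heq.symm, hrel _ (hball hc).1 _ hqU heq⟩

theorem ProjFoliation.smul_mem_leaf {n d : ℕ} (F : ProjFoliation n d)
    {p q : Fin (n + 1) → ℂ} (hqp : q ∈ F.leaf p) (hq0 : q ≠ 0) (hq : q ∉ F.singCone) {c : ℂ}
    (hc : c ≠ 0) : c • q ∈ F.leaf p := by
  have hconn : IsPreconnected ({0}ᶜ : Set ℂ) :=
    (isConnected_compl_singleton_of_one_lt_rank (by simp) 0).isPreconnected
  have h := hconn.induction₂' (fun x y : ℂ => Relation.ReflTransGen F.PlaqueRel (x • q) (y • q))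
    (fun x hx => by
      have hx' : x ≠ 0 := hx
      have hdiv : Filter.Tendsto (fun y : ℂ => y / x) (𝓝[{0}ᶜ] x) (𝓝 1) := by
        have : ContinuousAt (fun y : ℂ => y / x) x := by fun_prop
        rw [ContinuousAt, div_self hx'] at this
        exact this.mono_left nhdsWithin_le_nhds
      filter_upwards [hdiv.eventually (F.eventually_plaqueRel_smul (smul_ne_zero hx' hq0)
        (F.smul_notMem_singCone hq hx'))] with y hy
      rw [smul_smul, div_mul_cancel₀ _ hx'] at hy
      exact ⟨.single hy.1, .single hy.2⟩)
    (fun x y z _ _ _ hxy hyz => hxy.trans hyz) (x := 1) (y := c) one_ne_zero hc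
  rw [one_smul] at h
  exact Relation.ReflTransGen.trans hqp h

theorem ProjFoliation.eventually_mem_closure_leaf {n d : ℕ} (F : ProjFoliation n d)
    {p m : Fin (n + 1) → ℂ} (hm0 : m ≠ 0) (hm : m ∉ F.singCone) (hmp : m ∈ closure (F.leaf p)) :
    ∃ f : (Fin (n + 1) → ℂ) → ℂ, AnalyticAt ℂ f m ∧ ∀ᶠ w in 𝓝 m, f w = f m →
      w ∈ closure (F.leaf p) := by
  obtain ⟨f, U, hU, hmU, hf, -, hrel⟩ := F.exists_plaque_chart hm0 hm
  refine ⟨f, (hf m hmU).1, ?_⟩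
  filter_upwards [hU.mem_nhds hmU] with w hw hwm
  rw [mem_closure_iff_nhds]
  intro N hN
  have hrange : (fderiv ℂ f w).range = ⊤ := LinearMap.range_eq_top.2
    (LinearMap.surjective fun h => (hf w hw).2 (ContinuousLinearMap.coe_injective h))
  have hopen : f '' (N ∩ U) ∈ 𝓝 (f m) := by
    rw [← hwm, ← (hf w hw).1.hasStrictFDerivAt.map_nhds_eq_of_surj hrange]
    exact Filter.image_mem_map (Filter.inter_mem hN (hU.mem_nhds hw))
  obtain ⟨q, ⟨hqU, w', ⟨hwN, hwU⟩, hfw⟩, hqL⟩ := mem_closure_iff_nhds.1 hmp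
    (U ∩ f ⁻¹' (f '' (N ∩ U))) (Filter.inter_mem (hU.mem_nhds hmU)
      ((hf m hmU).1.continuousAt hopen))
  exact ⟨w', hwN, Relation.ReflTransGen.tail hqL (hrel q hqU w' hwU hfw.symm)⟩

end

section
open scoped Topology

theorem exists_ne_zero_mem_zeros {σ τ : Type*} [Finite σ] {P : Ideal (MvPolynomial σ ℂ)}
    [hP : P.IsPrime] [Nonempty τ] {u : τ → MvPolynomial σ ℂ}
    (hu : ∀ r : MvPolynomial τ ℂ, aeval u r ∈ P → r = 0) :
    ∃ z : σ → ℂ, (∀ p ∈ P, eval z p = 0) ∧ z ≠ 0 := by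
  by_contra! h
  obtain ⟨i⟩ := ‹Nonempty τ›
  have hmem : u i - C (eval 0 (u i)) ∈ vanishingIdeal ℂ (zeroLocus ℂ P) := by
    rw [mem_vanishingIdeal_iff]
    intro z hz
    have hz0 : z = 0 := h z fun p hp => by
      have := (mem_zeroLocus_iff.1 hz) p hp
      rwa [aeval_eq_eval] at this
    rw [hz0, aeval_eq_eval]
    simp
  rw [vanishingIdeal_zeroLocus_eq_radical, hP.radical] at hmem
  have h0 := hu (X i - C (eval 0 (u i))) (by simpa [algebraMap_eq] using hmem)
  have h1 := congrArg (eval fun _ => eval 0 (u i) + 1) h0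
  simp at h1

theorem ProjFoliation.closure_leaf_inter_singCone_nonempty {n d : ℕ} (hn : 2 < n)
    (F : ProjFoliation n d) {p : Fin (n + 1) → ℂ} (hp : p ≠ 0) :
    (closure (F.leaf p) ∩ F.singCone).Nonempty := by
  by_contra hempty
  rw [Set.not_nonempty_iff_eq_empty, ← Set.disjoint_iff_inter_eq_empty] at hempty
  obtain ⟨P, hP, hPa, hPhom, u, hu⟩ := F.exists_homogeneous_prime hn
  obtain ⟨k, hk, Y, D, hY⟩ := exists_noether_projection hu
  have hfin : IsFiniteProjection {z : Fin (n + 1) → ℂ | ∀ p ∈ P, eval z p = 0} Y D := hY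
  have hreg : ∀ q ∈ closure (F.leaf p), q ∉ F.singCone := fun q hq hs =>
    Set.disjoint_left.1 hempty hq hs
  have hne0 : ∀ q ∈ F.leaf p, q ≠ 0 := by
    intro q hq
    rcases Relation.ReflTransGen.cases_tail hq with h | ⟨q', -, U, -, hU0, -, f, -, -, -, -, hq⟩
    · rwa [h]
    · exact hU0 q (connectedComponentIn_subset _ _ hq).1
  refine hfin.not_disjoint_of_levelSets hk ?_ (fun t z hz => eval_smul_eq_zero_of_mem hPhom hz t)
    (exists_ne_zero_mem_zeros hu) (M := closure (F.leaf p) \ {0})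
    ⟨p, subset_closure Relation.ReflTransGen.refl, hp⟩ (fun h => h.2 rfl) ?_ ?_ ?_ ?_
  · simp only [Set.ofPred_forall]
    exact isClosed_iInter fun q => isClosed_iInter fun _ =>
      isClosed_eq (MvPolynomial.continuous_eval q) continuous_const
  · rw [Set.insert_sdiff_singleton]
    exact isClosed_singleton.union isClosed_closure
  · intro t ht w hw
    refine ⟨?_, smul_ne_zero ht hw.2⟩
    exact map_mem_closure (f := fun w => t • w) (continuous_const_smul t) hw.1 fun q hq =>
      F.smul_mem_leaf hq (hne0 q hq) (hreg q (subset_closure hq)) ht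
  · intro m hm
    obtain ⟨f, hf, hev⟩ := F.eventually_mem_closure_leaf hm.2 (hreg m hm.1) hm.1
    refine ⟨f, hf, ?_⟩
    filter_upwards [hev, eventually_ne_nhds (show m ≠ 0 from hm.2)] with w hw hw0 hwm
    exact ⟨hw hwm, hw0⟩
  · exact Set.disjoint_left.2 fun z hz hzP => hreg z hz.1 ⟨hz.2, fun i => hzP _ (hPa i)⟩

end

/-- No holomorphic foliation on `ℂℙⁿ`, `n > 2`, has a nontrivial minimal set;
equivalently, the closure of every leaf meets the singular locus. -/
theorem no_nontrivial_minimal_set_in_CPn (n d : ℕ) (hn : 2 < n)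
    (F : ProjFoliation n d) :
    (¬ ∃ Y : Set (Fin (n + 1) → ℂ), F.IsNontrivialMinimalSet Y) ∧
    (∀ p : Fin (n + 1) → ℂ, p ≠ 0 → p ∉ F.singCone →
      (closure (F.leaf p) ∩ F.singCone).Nonempty) := by
  refine ⟨?_, fun p hp _ => F.closure_leaf_inter_singCone_nonempty hn hp⟩
  rintro ⟨Y, ⟨p, hp⟩, hY0, -, hYc, hYinv, hYdisj, -⟩
  obtain ⟨q, hq, hqs⟩ := F.closure_leaf_inter_singCone_nonempty hn (hY0 p hp)
  exact Set.disjoint_left.1 hYdisj (hYc q (closure_mono (hYinv p hp) hq) hqs.1) hqs
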